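/- Let P be a simple polygon and let Π be a connected curve contained in P that intersects every nonredundant cut of P. Then for every nonredundant cut C of P, every vertex of Pocket(C) is visible from some point of Π. -/

import Mathlib

open Set

noncomputable section

/-- The Euclidean plane. -/
abbrev E2 := EuclideanSpace ℝ (Fin 2)

/-- A simple polygon in the plane, given by its cyclic sequence of vertices.
Adjacent edges meet exactly at their common vertex, and non-adjacent edges
are disjoint, so the boundary is a simple closed polygonal curve. -/
structure SimplePolygon where
  n : ℕ
  three_le : 3 ≤ n
  vtx : ZMod n → E2
  inj : Function.Injective vtx
  adj_edges : ∀ i : ZMod n,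
    segment ℝ (vtx i) (vtx (i + 1)) ∩ segment ℝ (vtx (i + 1)) (vtx (i + 2)) = {vtx (i + 1)}
  nonadj_edges : ∀ i j : ZMod n, i ≠ j → i + 1 ≠ j → j + 1 ≠ i →
    segment ℝ (vtx i) (vtx (i + 1)) ∩ segment ℝ (vtx j) (vtx (j + 1)) = ∅

namespace SimplePolygon

variable (P : SimplePolygon)

/-- The boundary `∂P`: the union of the edges. -/
def boundary : Set E2 := ⋃ i : ZMod P.n, segment ℝ (P.vtx i) (P.vtx (i + 1))

/-- The compact region bounded by `∂P`: the boundary together with all points of the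
bounded connected components of its complement. -/
def region : Set E2 :=
  P.boundary ∪ {x | x ∉ P.boundary ∧ Bornology.IsBounded (connectedComponentIn P.boundaryᶜ x)}

/-- `x` sees `y` (in `P`) if the closed segment `[x,y]` is contained in `P`. -/
def Visible (x y : E2) : Prop := segment ℝ x y ⊆ P.region

/-- The vertex `vtx i` is reflex: its internal angle is strictly larger than `π`, i.e.
near the vertex the midpoint of two points at equal small parameter along the two
incident edges lies outside the region. -/
def IsReflex (i : ZMod P.n) : Prop :=
  ∃ ε₀ > (0 : ℝ), ∀ ε ∈ Set.Ioo (0 : ℝ) ε₀,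
    midpoint ℝ (P.vtx i + ε • (P.vtx (i - 1) - P.vtx i))
               (P.vtx i + ε • (P.vtx (i + 1) - P.vtx i)) ∉ P.region

/-- `P` is star-shaped if a single point of `P` sees all of `P`. -/
def IsStarShaped : Prop := ∃ x ∈ P.region, ∀ y ∈ P.region, P.Visible x y

/-- A visibility path: a connected curve inside `P` from which every point of `P`
is visible. -/
def IsVisibilityPath (Pth : Set E2) : Prop :=
  IsConnected Pth ∧ Pth ⊆ P.region ∧ ∀ x ∈ P.region, ∃ p ∈ Pth, P.Visible x p

/-- The pocket, inside `P`, determined by a cut segment `s` on the side of the point `u`: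
the closure of the connected component of `P \ s` containing `u`, together with `s`. -/
def pocketOfSeg (s : Set E2) (u : E2) : Set E2 :=
  closure (connectedComponentIn (P.region \ s) u) ∪ s

end SimplePolygon

/-- A cut of a simple polygon `P`: for a reflex vertex `v = vtx i` with adjacent
vertex `u = vtx j`, the segment from `v` to the closest point `w` of `∂P` hit by
the ray from `v` in the direction from `u` to `v`. -/
structure SimplePolygon.Cut (P : SimplePolygon) where
  i : ZMod P.n
  j : ZMod P.n
  adj : j = i + 1 ∨ j = i - 1
  reflex : P.IsReflex i
  t : ℝ
  t_pos : 0 < t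
  hits : P.vtx i + t • (P.vtx i - P.vtx j) ∈ P.boundary
  first_hit : ∀ s ∈ Set.Ioo (0 : ℝ) t, P.vtx i + s • (P.vtx i - P.vtx j) ∉ P.boundary
  inside : segment ℝ (P.vtx i) (P.vtx i + t • (P.vtx i - P.vtx j)) ⊆ P.region

namespace SimplePolygon.Cut

variable {P : SimplePolygon} (C : P.Cut)

/-- The reflex vertex generating the cut. -/
def v : E2 := P.vtx C.i

/-- The adjacent vertex `u`; the edge `u v` is the generator of the cut. -/
def u : E2 := P.vtx C.j

/-- The other endpoint of the cut, on `∂P`. -/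
def w : E2 := P.vtx C.i + C.t • (P.vtx C.i - P.vtx C.j)

/-- The cut as a segment. -/
def seg : Set E2 := segment ℝ C.v C.w

/-- `Pocket(C)`: the part of `P` cut off by `C` that contains the generator vertex `u`. -/
def pocket : Set E2 := P.pocketOfSeg C.seg C.u

/-- A cut is redundant if the pocket of some cut is strictly contained in its pocket. -/
def Redundant : Prop := ∃ C' : P.Cut, C'.pocket ⊂ C.pocket

/-- A nonredundant (essential) cut. -/
def Nonredundant : Prop := ¬ C.Redundant

/-- `x` is a vertex of the polygon `Pocket(C)`: either the endpoint `w` of the cut, or a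
vertex of `P` belonging to the pocket. -/
def PocketVertex (x : E2) : Prop :=
  x = C.w ∨ ∃ k : ZMod P.n, P.vtx k = x ∧ x ∈ C.pocket

end SimplePolygon.Cut

/-- Length of a polygonal path given by its list of vertices. -/
def polyLength (l : List E2) : ℝ := ((l.zip l.tail).map fun p => dist p.1 p.2).sum

namespace SimplePolygon

variable (P : SimplePolygon)

/-- A polygonal path inside `P`: a nonempty list of points with each consecutive
segment contained in `P`. -/
def IsPolyPathIn (l : List E2) : Prop :=
  l ≠ [] ∧ List.Chain' (fun a b => segment ℝ a b ⊆ P.region) l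

/-- `l` is a shortest Euclidean (polygonal) path inside `P` from `x` to the set `S`. -/
def IsGeodesicTo (x : E2) (S : Set E2) (l : List E2) : Prop :=
  P.IsPolyPathIn l ∧ l.head? = some x ∧ (∃ y ∈ S, l.getLast? = some y) ∧
  ∀ m : List E2, P.IsPolyPathIn m → m.head? = some x →
    (∃ y ∈ S, m.getLast? = some y) → polyLength l ≤ polyLength m

/-- The subpolygon `Q` of `P` obtained by cutting `P` along all nonredundant cuts:
the closure of `P` minus the union of the pockets of all nonredundant cuts. -/
def core : Set E2 :=
  closure (P.region \ ⋃ C : {C : P.Cut // C.Nonredundant}, (C : P.Cut).pocket)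

end SimplePolygon

/-- The planar cross product. -/
def cross2 (a b : E2) : ℝ := a 0 * b 1 - a 1 * b 0

/-- A polygonal chain all of whose turns have the sign `s` (a convex chain bending
consistently to one side). -/
def ConvexChain (s : ℝ) (l : List E2) : Prop :=
  ∀ p q r : E2, [p, q, r] <:+: l → 0 ≤ s * cross2 (q - p) (r - q)

open Filter Topology

/-! ### Plane vectors -/

theorem cross2_add_left (a b c : E2) : cross2 (a + b) c = cross2 a c + cross2 b c := by
  simp [cross2]; ring

theorem cross2_add_right (a b c : E2) : cross2 a (b + c) = cross2 a b + cross2 a c := by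
  simp [cross2]; ring

theorem cross2_smul_left (k : ℝ) (a b : E2) : cross2 (k • a) b = k * cross2 a b := by
  simp [cross2]; ring

theorem cross2_smul_right (k : ℝ) (a b : E2) : cross2 a (k • b) = k * cross2 a b := by
  simp [cross2]; ring

theorem cross2_neg_left (a b : E2) : cross2 (-a) b = -cross2 a b := by
  simp [cross2]; ring

theorem cross2_neg_right (a b : E2) : cross2 a (-b) = -cross2 a b := by
  simp [cross2]; ring

theorem cross2_self (a : E2) : cross2 a a = 0 := by
  simp [cross2]; ring

theorem cross2_swap (a b : E2) : cross2 a b = -cross2 b a := by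
  simp [cross2]; ring

theorem cross2_zero_left (a : E2) : cross2 0 a = 0 := by simp [cross2]

theorem cross2_zero_right (a : E2) : cross2 a 0 = 0 := by simp [cross2]

theorem cross2_plucker (a b c d : E2) :
    cross2 a b * cross2 c d - cross2 a c * cross2 b d + cross2 a d * cross2 b c = 0 := by
  simp [cross2]; ring

theorem exists_smul_of_cross2_eq_zero {a b : E2} (ha : a ≠ 0) (h : cross2 a b = 0) :
    ∃ k : ℝ, b = k • a := by
  have hn : a 0 ^ 2 + a 1 ^ 2 ≠ 0 := by
    intro h0
    apply ha
    ext i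
    fin_cases i <;> simp <;> nlinarith [sq_nonneg (a 0), sq_nonneg (a 1)]
  refine ⟨(a 0 * b 0 + a 1 * b 1) / (a 0 ^ 2 + a 1 ^ 2), ?_⟩
  unfold cross2 at h
  ext i
  fin_cases i
  · simp only [PiLp.smul_apply, smul_eq_mul, Fin.zero_eta]
    field_simp
    linear_combination (-a 1) * h
  · simp only [PiLp.smul_apply, smul_eq_mul, Fin.mk_one]
    field_simp
    linear_combination (a 0) * h

theorem exists_cross2_pos {a : E2} (ha : a ≠ 0) : ∃ n, 0 < cross2 a n := by
  by_contra! h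
  apply ha
  have h1 := h !₂[-a 1, a 0]
  simp [cross2] at h1
  ext i
  fin_cases i <;> simp <;> nlinarith [sq_nonneg (a 0), sq_nonneg (a 1)]

/-- The standard identification of the plane with the complex numbers. -/
def toC (p : E2) : ℂ := ⟨p 0, p 1⟩

theorem toC_add (a b : E2) : toC (a + b) = toC a + toC b := by
  apply Complex.ext <;> simp [toC]

theorem toC_neg (a : E2) : toC (-a) = -toC a := by
  apply Complex.ext <;> simp [toC]

theorem toC_smul (k : ℝ) (a : E2) : toC (k • a) = k * toC a := by
  apply Complex.ext <;> simp [toC]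

theorem toC_injective : Function.Injective toC := by
  intro a b h
  have h0 := congrArg Complex.re h
  have h1 := congrArg Complex.im h
  ext i
  fin_cases i
  · exact h0
  · exact h1

theorem toC_eq_zero {a : E2} : toC a = 0 ↔ a = 0 := by
  have h0 : toC 0 = 0 := by apply Complex.ext <;> simp [toC]
  rw [← h0]
  exact toC_injective.eq_iff

theorem continuous_toC : Continuous toC := by
  have : toC = fun p : E2 => ((p 0 : ℝ) : ℂ) + ((p 1 : ℝ) : ℂ) * Complex.I := by
    funext p; apply Complex.ext <;> simp [toC]
  rw [this]
  fun_prop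

theorem norm_toC (a : E2) : ‖toC a‖ = ‖a‖ := by
  rw [EuclideanSpace.norm_eq, Complex.norm_def]
  simp [toC, Complex.normSq_apply, Fin.sum_univ_two, sq]

/-! ### Angles and winding functions -/

/-- The signed angle, in `(-π, π]`, under which the segment from `a` to `b` is seen from `q`. -/
def viewAngle (a b q : E2) : ℝ := Complex.arg (toC (b - q) / toC (a - q))

theorem ratio_mem_slitPlane {a b q : E2} (h : q ∉ segment ℝ a b) :
    toC (b - q) / toC (a - q) ∈ Complex.slitPlane := by
  by_contra hs
  apply h
  by_cases ha : a = q
  · subst ha; exact left_mem_segment ℝ _ _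
  have ha' : toC (a - q) ≠ 0 := by rwa [Ne, toC_eq_zero, sub_eq_zero]
  set c := toC (b - q) / toC (a - q) with hc
  have hc0 : c.re ≤ 0 ∧ c.im = 0 := by
    rw [Complex.mem_slitPlane_iff] at hs
    push Not at hs
    exact hs
  have hcr : c = ((c.re : ℝ) : ℂ) := Complex.ext rfl (by simp [hc0.2])
  have h1 : toC (b - q) = c * toC (a - q) := by rw [hc]; field_simp
  rw [hcr, ← toC_smul] at h1
  have h2 := toC_injective h1
  have h3 : b = q + c.re • (a - q) := by rw [← h2]; abel
  have hp : 0 < 1 - c.re := by linarith [hc0.1]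
  refine ⟨-c.re / (1 - c.re), 1 / (1 - c.re), div_nonneg (by linarith [hc0.1]) hp.le,
    by positivity, by field_simp; ring, ?_⟩
  rw [h3]
  have hp' := hp.ne'
  ext i
  simp
  field_simp
  ring

theorem continuousAt_viewAngle {a b q : E2} (h : q ∉ segment ℝ a b) :
    ContinuousAt (viewAngle a b) q := by
  have ha : toC (a - q) ≠ 0 := by
    rw [Ne, toC_eq_zero, sub_eq_zero]
    rintro rfl
    exact h (left_mem_segment ℝ _ _)
  unfold viewAngle
  refine ContinuousAt.comp (g := Complex.arg)
    (f := fun q => toC (b - q) / toC (a - q)) (Complex.continuousAt_arg (ratio_mem_slitPlane h)) ?_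
  refine ContinuousAt.div ?_ ?_ ha
  · exact (continuous_toC.comp (continuous_const.sub continuous_id)).continuousAt
  · exact (continuous_toC.comp (continuous_const.sub continuous_id)).continuousAt

theorem viewAngle_self (a q : E2) : viewAngle a a q = 0 := by
  unfold viewAngle
  by_cases h : toC (a - q) = 0
  · simp [h]
  · simp [div_self h]

theorem viewAngle_swap {a b q : E2} (h : q ∉ segment ℝ a b) :
    viewAngle b a q = -viewAngle a b q := by
  have hs := Complex.mem_slitPlane_iff_arg.1 (ratio_mem_slitPlane h)
  unfold viewAngle
  rw [← inv_div, Complex.arg_inv, if_neg hs.1]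

theorem coe_viewAngle {a b q : E2} (ha : a ≠ q) (hb : b ≠ q) :
    (viewAngle a b q : Real.Angle) =
      (Complex.arg (toC (b - q)) : Real.Angle) - (Complex.arg (toC (a - q)) : Real.Angle) := by
  unfold viewAngle
  apply Complex.arg_div_coe_angle
  · rwa [Ne, toC_eq_zero, sub_eq_zero]
  · rwa [Ne, toC_eq_zero, sub_eq_zero]

theorem tendsto_viewAngle_cobounded (a b : E2) :
    Tendsto (viewAngle a b) (Bornology.cobounded E2) (𝓝 0) := by
  unfold viewAngle
  have h0 : Complex.arg 1 = 0 := Complex.arg_one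
  rw [← h0]
  refine (Complex.continuousAt_arg Complex.one_mem_slitPlane).tendsto.comp ?_
  have hsub : Tendsto (fun q => toC (a - q)) (Bornology.cobounded E2) (Bornology.cobounded ℂ) := by
    rw [← tendsto_norm_atTop_iff_cobounded]
    simp only [norm_toC]
    rw [tendsto_norm_atTop_iff_cobounded]
    exact tendsto_const_sub_cobounded a
  have h1 : Tendsto (fun q => 1 + toC (b - a) * (toC (a - q))⁻¹) (Bornology.cobounded E2)
      (𝓝 (1 + toC (b - a) * 0)) :=
    (((tendsto_inv₀_cobounded (α := ℂ)).comp hsub).const_mul _).const_add _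
  rw [mul_zero, add_zero] at h1
  refine h1.congr' ?_
  have hne : ∀ᶠ q in Bornology.cobounded E2, toC (a - q) ≠ 0 :=
    hsub.eventually (Bornology.eventually_ne_cobounded 0)
  filter_upwards [hne] with q hq
  have : b - q = (b - a) + (a - q) := by abel
  rw [this, toC_add]
  field_simp
  ring

/-- A real function is constant on a preconnected set where it is continuous and takes values in
the multiples of `2π`. -/
theorem eq_of_isPreconnected_of_coe_angle {f : E2 → ℝ} {s : Set E2} (hs : IsPreconnected s)
    (hf : ContinuousOn f s) (hint : ∀ q ∈ s, (f q : Real.Angle) = 0) {x y : E2} (hx : x ∈ s)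
    (hy : y ∈ s) : f x = f y := by
  wlog hlt : f x ≤ f y generalizing x y
  · exact (this hy hx (le_of_not_ge hlt)).symm
  by_contra hne
  have hlt' : f x < f y := lt_of_le_of_ne hlt hne
  set c := min (f y) (f x + Real.pi) with hc
  have hpi := Real.pi_pos
  have hcx : f x < c := lt_min hlt' (by linarith)
  obtain ⟨z, hz, hzc⟩ := hs.intermediate_value hx hy hf ⟨hcx.le, min_le_left _ _⟩
  obtain ⟨m, hm⟩ := Real.Angle.coe_eq_zero_iff.1 (hint z hz)
  obtain ⟨n, hn⟩ := Real.Angle.coe_eq_zero_iff.1 (hint x hx)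
  have hcle : c ≤ f x + Real.pi := min_le_right _ _
  rw [← hzc, ← hm, ← hn] at hcx hcle
  simp only [zsmul_eq_mul] at hcx hcle
  have h1 : (n : ℝ) < m := by nlinarith
  have h2 : (m : ℝ) < n + 1 := by nlinarith
  norm_cast at h1 h2
  omega

/-- `F` behaves like the winding number (times `2π`) of a closed curve with trace `G`. -/
structure IsWinding (F : E2 → ℝ) (G : Set E2) : Prop where
  isClosed : IsClosed G
  continuousAt : ∀ q ∉ G, ContinuousAt F q
  coe_angle : ∀ q ∉ G, (F q : Real.Angle) = 0
  far : Tendsto F (Bornology.cobounded E2) (𝓝 0)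

theorem IsWinding.eq_of_isPreconnected {F : E2 → ℝ} {G s : Set E2} (h : IsWinding F G)
    (hs : IsPreconnected s) (hsG : Disjoint s G) {x y : E2} (hx : x ∈ s) (hy : y ∈ s) :
    F x = F y :=
  eq_of_isPreconnected_of_coe_angle hs
    (fun q hq => (h.continuousAt q (disjoint_left.1 hsG hq)).continuousWithinAt)
    (fun q hq => h.coe_angle q (disjoint_left.1 hsG hq)) hx hy

theorem IsWinding.eq_zero {F : E2 → ℝ} {G s : Set E2} (h : IsWinding F G)
    (hs : IsPreconnected s) (hsG : Disjoint s G) (hb : ¬ Bornology.IsBounded s) {x : E2}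
    (hx : x ∈ s) : F x = 0 := by
  have hne : (Bornology.cobounded E2 ⊓ 𝓟 s).NeBot := by
    rw [← Filter.frequently_mem_iff_neBot]
    intro hev
    exact hb (Bornology.isBounded_def.2 hev)
  have h1 : Tendsto F (Bornology.cobounded E2 ⊓ 𝓟 s) (𝓝 0) := h.far.mono_left inf_le_left
  have h2 : Tendsto F (Bornology.cobounded E2 ⊓ 𝓟 s) (𝓝 (F x)) := by
    refine (tendsto_const_nhds (x := F x)).congr' ?_
    filter_upwards [mem_inf_of_right (mem_principal_self s)] with q hq
    exact h.eq_of_isPreconnected hs hsG hx hq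
  exact tendsto_nhds_unique h2 h1

theorem viewAngle_add {a b y q : E2} (hy : y ∈ segment ℝ a b) (hq : q ∉ segment ℝ a b) :
    viewAngle a y q + viewAngle y b q = viewAngle a b q := by
  have hay : ∀ y ∈ segment ℝ a b, segment ℝ a y ⊆ segment ℝ a b := fun y hy =>
    (convex_segment a b).segment_subset (left_mem_segment ℝ _ _) hy
  have hyb : ∀ y ∈ segment ℝ a b, segment ℝ y b ⊆ segment ℝ a b := fun y hy =>
    (convex_segment a b).segment_subset hy (right_mem_segment ℝ _ _)
  have hne : ∀ y ∈ segment ℝ a b, y ≠ q := fun y hy h => hq (h ▸ hy)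
  have hcont : ContinuousOn (fun y => viewAngle a y q + viewAngle y b q
      - viewAngle a b q) (segment ℝ a b) := by
    have h1 : ContinuousOn (fun y => viewAngle a y q) (segment ℝ a b) := by
      intro y hy
      unfold viewAngle
      refine (ContinuousAt.comp (g := Complex.arg) (f := fun y => toC (y - q) / toC (a - q))
        (Complex.continuousAt_arg (ratio_mem_slitPlane fun h => hq (hay y hy h)))
        ?_).continuousWithinAt
      exact ((continuous_toC.comp (continuous_id.sub continuous_const)).div_const _).continuousAt
    have h2 : ContinuousOn (fun y => viewAngle y b q) (segment ℝ a b) := by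
      intro y hy
      unfold viewAngle
      refine (ContinuousAt.comp (g := Complex.arg) (f := fun y => toC (b - q) / toC (y - q))
        (Complex.continuousAt_arg (ratio_mem_slitPlane fun h => hq (hyb y hy h)))
        ?_).continuousWithinAt
      refine ContinuousAt.div continuousAt_const
        (continuous_toC.comp (continuous_id.sub continuous_const)).continuousAt ?_
      rw [Ne, toC_eq_zero, sub_eq_zero]
      exact hne y hy
    exact (h1.add h2).sub continuousOn_const
  have key := eq_of_isPreconnected_of_coe_angle (convex_segment a b).isPreconnected hcont ?_
    (left_mem_segment ℝ a b) hy
  · simp only [viewAngle_self] at key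
    linarith
  · intro y hy
    have ha := hne a (left_mem_segment ℝ a b)
    have hb := hne b (right_mem_segment ℝ a b)
    simp only [Real.Angle.coe_add, Real.Angle.coe_sub]
    rw [coe_viewAngle ha (hne y hy), coe_viewAngle (hne y hy) hb, coe_viewAngle ha hb]
    simp

theorem viewAngle_reflect {q₀ d g : E2} (h : q₀ + g ∉ segment ℝ (q₀ + d) (q₀ - d)) :
    viewAngle (q₀ + d) (q₀ - d) (q₀ - g) = -viewAngle (q₀ + d) (q₀ - d) (q₀ + g) := by
  rw [← viewAngle_swap h]
  unfold viewAngle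
  have h1 : q₀ - d - (q₀ - g) = -(q₀ + d - (q₀ + g)) := by abel
  have h2 : q₀ + d - (q₀ - g) = -(q₀ - d - (q₀ + g)) := by abel
  rw [h1, h2, toC_neg, toC_neg, neg_div_neg_eq]

/-! ### Corners -/

/-- Near `q`, within distance `r`, the set `G` consists of the two rays from `q` in the directions
`d₁` and `d₂`, the counterclockwise angle from `d₁` to `d₂` being in `(0, π]`. -/
structure CornerAt (G : Set E2) (q d₁ d₂ : E2) (r : ℝ) : Prop where
  pos : 0 < r
  cross_nonneg : 0 ≤ cross2 d₁ d₂
  exists_between : ∃ n, 0 < cross2 d₁ n ∧ 0 < cross2 n d₂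
  mem_iff : ∀ g : E2, ‖g‖ < r →
    (q + g ∈ G ↔ (∃ k : ℝ, 0 ≤ k ∧ g = k • d₁) ∨ ∃ k : ℝ, 0 ≤ k ∧ g = k • d₂)

/-- The part, near `q`, of the open sector between `d₁` and `d₂`. -/
def narrowSector (q d₁ d₂ : E2) (r : ℝ) : Set E2 :=
  {p | ‖p - q‖ < r ∧ 0 < cross2 d₁ (p - q) ∧ 0 < cross2 (p - q) d₂}

/-- The part, near `q`, of the open sector opposite to the one between `d₁` and `d₂`. -/
def wideSector (q d₁ d₂ : E2) (r : ℝ) : Set E2 :=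
  {p | ‖p - q‖ < r ∧ (cross2 d₁ (p - q) < 0 ∨ cross2 (p - q) d₂ < 0)}

namespace CornerAt

variable {G : Set E2} {q d₁ d₂ : E2} {r : ℝ}

theorem left_ne_zero (h : CornerAt G q d₁ d₂ r) : d₁ ≠ 0 := by
  rintro rfl
  obtain ⟨n, hn, -⟩ := h.exists_between
  simp [cross2_zero_left] at hn

theorem right_ne_zero (h : CornerAt G q d₁ d₂ r) : d₂ ≠ 0 := by
  rintro rfl
  obtain ⟨n, -, hn⟩ := h.exists_between
  simp [cross2_zero_right] at hn

theorem neg_of_cross_eq_zero (h : CornerAt G q d₁ d₂ r) (h0 : cross2 d₁ d₂ = 0) :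
    ∃ t : ℝ, t < 0 ∧ d₂ = t • d₁ := by
  obtain ⟨t, ht⟩ := exists_smul_of_cross2_eq_zero h.left_ne_zero h0
  obtain ⟨n, hn, hn'⟩ := h.exists_between
  refine ⟨t, ?_, ht⟩
  rw [ht, cross2_smul_right, cross2_swap] at hn'
  by_contra! htn
  nlinarith

theorem notMem_iff (h : CornerAt G q d₁ d₂ r) {g : E2} (hg : ‖g‖ < r) :
    q + g ∉ G ↔ (0 < cross2 d₁ g ∧ 0 < cross2 g d₂) ∨ (cross2 d₁ g < 0 ∨ cross2 g d₂ < 0) := by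
  rw [h.mem_iff g hg]
  have hc := h.cross_nonneg
  constructor
  · intro hn
    by_contra! hcon
    obtain ⟨h1, h2, h3⟩ := hcon
    apply hn
    by_cases h0 : cross2 d₁ g = 0
    · obtain ⟨s, rfl⟩ := exists_smul_of_cross2_eq_zero h.left_ne_zero h0
      by_cases hs : 0 ≤ s
      · exact Or.inl ⟨s, hs, rfl⟩
      · rw [cross2_smul_left] at h3
        have hc0 : cross2 d₁ d₂ = 0 := by push Not at hs; nlinarith
        obtain ⟨t, ht, rfl⟩ := h.neg_of_cross_eq_zero hc0
        refine Or.inr ⟨s / t, div_nonneg_of_nonpos (by linarith) ht.le, ?_⟩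
        rw [smul_smul, div_mul_cancel₀ _ ht.ne]
    · have h4 : cross2 g d₂ = 0 := le_antisymm (h1 (lt_of_le_of_ne h2 (Ne.symm h0))) h3
      have h5 : cross2 d₂ g = 0 := by rw [cross2_swap, h4, neg_zero]
      obtain ⟨s, rfl⟩ := exists_smul_of_cross2_eq_zero h.right_ne_zero h5
      refine Or.inr ⟨s, ?_, rfl⟩
      rw [cross2_smul_right] at h2 h0
      by_contra! hs
      have : cross2 d₁ d₂ = 0 := by nlinarith
      simp [this] at h0
  · rintro hor (⟨k, hk, rfl⟩ | ⟨k, hk, rfl⟩)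
    · simp only [cross2_smul_left, cross2_smul_right, cross2_self, mul_zero] at hor
      have : 0 ≤ k * cross2 d₁ d₂ := by positivity
      rcases hor with h | h | h <;> linarith [h]
    · simp only [cross2_smul_left, cross2_smul_right, cross2_self, mul_zero] at hor
      have : 0 ≤ k * cross2 d₁ d₂ := by positivity
      rcases hor with h | h | h <;> linarith [h]

theorem disjoint_narrow (h : CornerAt G q d₁ d₂ r) : Disjoint (narrowSector q d₁ d₂ r) G := by
  rw [disjoint_left]
  rintro p ⟨hp, hp'⟩
  have := (h.notMem_iff hp).2 (Or.inl hp')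
  rwa [add_sub_cancel] at this

theorem disjoint_wide (h : CornerAt G q d₁ d₂ r) : Disjoint (wideSector q d₁ d₂ r) G := by
  rw [disjoint_left]
  rintro p ⟨hp, hp'⟩
  have := (h.notMem_iff hp).2 (Or.inr hp')
  rwa [add_sub_cancel] at this

theorem mem_sector (h : CornerAt G q d₁ d₂ r) {p : E2} (hp : ‖p - q‖ < r) (hpG : p ∉ G) :
    p ∈ narrowSector q d₁ d₂ r ∨ p ∈ wideSector q d₁ d₂ r := by
  have := (h.notMem_iff hp).1 (by rwa [add_sub_cancel])
  exact this.imp (fun h => ⟨hp, h⟩) (fun h => ⟨hp, h⟩)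

theorem isPreconnected_narrow : IsPreconnected (narrowSector q d₁ d₂ r) := by
  apply Convex.isPreconnected
  rintro x ⟨hx, hx1, hx2⟩ y ⟨hy, hy1, hy2⟩ a b ha hb hab
  have he : a • x + b • y - q = a • (x - q) + b • (y - q) := by
    have : q = a • q + b • q := by rw [← add_smul, hab, one_smul]
    nth_rw 1 [this]
    module
  have hball := (convex_ball (0 : E2) r) (mem_ball_zero_iff.2 hx) (mem_ball_zero_iff.2 hy) ha hb hab
  refine ⟨by rw [he]; exact mem_ball_zero_iff.1 hball, ?_, ?_⟩
  · rw [he, cross2_add_right, cross2_smul_right, cross2_smul_right]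
    rcases ha.eq_or_lt with rfl | ha'
    · have : b = 1 := by linarith
      subst this; linarith
    · have := mul_pos ha' hx1
      have := mul_nonneg hb hy1.le
      linarith
  · rw [he, cross2_add_left, cross2_smul_left, cross2_smul_left]
    rcases ha.eq_or_lt with rfl | ha'
    · have : b = 1 := by linarith
      subst this; linarith
    · have := mul_pos ha' hx2
      have := mul_nonneg hb hy2.le
      linarith

theorem _root_.convex_halfDisc (q d : E2) (r : ℝ) :
    Convex ℝ {p : E2 | ‖p - q‖ < r ∧ cross2 d (p - q) < 0} := by
  rintro x ⟨hx, hx1⟩ y ⟨hy, hy1⟩ a b ha hb hab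
  have he : a • x + b • y - q = a • (x - q) + b • (y - q) := by
    have : q = a • q + b • q := by rw [← add_smul, hab, one_smul]
    nth_rw 1 [this]
    module
  have hball := (convex_ball (0 : E2) r) (mem_ball_zero_iff.2 hx) (mem_ball_zero_iff.2 hy) ha hb hab
  refine ⟨by rw [he]; exact mem_ball_zero_iff.1 hball, ?_⟩
  rw [he, cross2_add_right, cross2_smul_right, cross2_smul_right]
  rcases ha.eq_or_lt with rfl | ha'
  · have : b = 1 := by linarith
    subst this; linarith
  · have := mul_neg_of_pos_of_neg ha' hx1
    have := mul_nonpos_of_nonneg_of_nonpos hb hy1.le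
    linarith

theorem _root_.exists_pos_smul_norm_lt (n : E2) {r : ℝ} (hr : 0 < r) :
    ∃ η : ℝ, 0 < η ∧ ∀ t, 0 ≤ t → t ≤ η → ‖t • n‖ < r := by
  refine ⟨r / (‖n‖ + 1), by positivity, fun t ht htη => ?_⟩
  rw [norm_smul, Real.norm_of_nonneg ht]
  have h1 : t * (‖n‖ + 1) ≤ r := by rwa [le_div_iff₀ (by positivity)] at htη
  rcases ht.eq_or_lt with rfl | ht'
  · simpa using hr
  · nlinarith

theorem isPreconnected_wide (h : CornerAt G q d₁ d₂ r) :
    IsPreconnected (wideSector q d₁ d₂ r) := by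
  have he : wideSector q d₁ d₂ r = {p : E2 | ‖p - q‖ < r ∧ cross2 d₁ (p - q) < 0} ∪
      {p : E2 | ‖p - q‖ < r ∧ cross2 (-d₂) (p - q) < 0} := by
    ext p
    simp only [wideSector, mem_ofPred_eq, mem_union, ← and_or_left, cross2_neg_left,
      cross2_swap (p - q)]
  obtain ⟨n, hn1, hn2⟩ := h.exists_between
  obtain ⟨η, hη, hlt⟩ := exists_pos_smul_norm_lt (-n) h.pos
  rw [he]
  refine IsPreconnected.union (q + η • (-n)) ?_ ?_ (convex_halfDisc _ _ _).isPreconnected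
    (convex_halfDisc _ _ _).isPreconnected
  · refine ⟨by simpa using hlt η hη.le le_rfl, ?_⟩
    rw [add_sub_cancel_left, cross2_smul_right, cross2_neg_right]
    nlinarith
  · refine ⟨by simpa using hlt η hη.le le_rfl, ?_⟩
    rw [add_sub_cancel_left, cross2_smul_right, cross2_neg_right, cross2_neg_left, neg_neg,
      cross2_swap]
    nlinarith

theorem _root_.mem_closure_of_forall_small {S : Set E2} {p n : E2} {η : ℝ} (hη : 0 < η)
    (h : ∀ t, 0 < t → t < η → p + t • n ∈ S) : p ∈ closure S := by
  have hc : Tendsto (fun t : ℝ => p + t • n) (𝓝[>] 0) (𝓝 p) := by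
    have : Continuous (fun t : ℝ => p + t • n) := by fun_prop
    have h0 := this.tendsto 0
    simp only [zero_smul, add_zero] at h0
    exact h0.mono_left nhdsWithin_le_nhds
  refine mem_closure_of_tendsto hc ?_
  filter_upwards [Ioo_mem_nhdsGT hη] with t ht using h t ht.1 ht.2

theorem mem_closure (h : CornerAt G q d₁ d₂ r) {p : E2} (hp : ‖p - q‖ < r) (hpG : p ∈ G) :
    p ∈ closure (narrowSector q d₁ d₂ r) ∧ p ∈ closure (wideSector q d₁ d₂ r) := by
  obtain ⟨n, hn1, hn2⟩ := h.exists_between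
  have hc := h.cross_nonneg
  have hg := (h.mem_iff (p - q) hp).1 (by rwa [add_sub_cancel])
  have hsmall : ∀ m : E2, ∃ η : ℝ, 0 < η ∧ ∀ t, 0 < t → t < η → ‖p + t • m - q‖ < r := by
    intro m
    obtain ⟨η, hη, hlt⟩ := exists_pos_smul_norm_lt m (sub_pos.2 hp)
    refine ⟨η, hη, fun t ht htη => ?_⟩
    have h1 := hlt t ht.le htη.le
    have h2 : p + t • m - q = (p - q) + t • m := by abel
    rw [h2]
    exact (norm_add_le _ _).trans_lt (by linarith)
  have hsub : ∀ (t : ℝ) (m : E2), p + t • m - q = (p - q) + t • m := fun t m => by abel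
  constructor
  · obtain ⟨η, hη, hlt⟩ := hsmall n
    refine mem_closure_of_forall_small hη (n := n) fun t ht htη => ⟨hlt t ht htη, ?_⟩
    have hp1 := mul_pos ht hn1
    have hp2 := mul_pos ht hn2
    rw [hsub]
    rcases hg with ⟨k, hk, hg⟩ | ⟨k, hk, hg⟩ <;> have hkc := mul_nonneg hk hc <;>
    · rw [hg]
      simp only [cross2_add_left, cross2_add_right, cross2_smul_left, cross2_smul_right,
        cross2_self, mul_zero]
      constructor <;> linarith
  · obtain ⟨η, hη, hlt⟩ := hsmall (-n)
    refine mem_closure_of_forall_small hη (n := -n) fun t ht htη => ⟨hlt t ht htη, ?_⟩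
    have hp1 := mul_pos ht hn1
    have hp2 := mul_pos ht hn2
    rw [hsub]
    rcases hg with ⟨k, hk, hg⟩ | ⟨k, hk, hg⟩
    · left
      rw [hg]
      simp only [cross2_add_right, cross2_smul_right, cross2_neg_right,
        cross2_self, mul_zero]
      linarith
    · right
      rw [hg]
      simp only [cross2_add_left, cross2_smul_left, cross2_neg_left, cross2_self, mul_zero]
      linarith

end CornerAt

theorem exists_cornerAt {G : Set E2} {q d₁ d₂ : E2} (h₁ : d₁ ≠ 0)
    (hpar : ∀ k : ℝ, 0 ≤ k → d₂ ≠ k • d₁) (hc : 0 ≤ cross2 d₁ d₂)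
    (hev : ∀ᶠ g in 𝓝 (0 : E2),
      (q + g ∈ G ↔ (∃ k : ℝ, 0 ≤ k ∧ g = k • d₁) ∨ ∃ k : ℝ, 0 ≤ k ∧ g = k • d₂)) :
    ∃ r, CornerAt G q d₁ d₂ r := by
  obtain ⟨r, hr, hball⟩ := Metric.eventually_nhds_iff_ball.1 hev
  refine ⟨r, hr, hc, ?_, fun g hg => hball g (mem_ball_zero_iff.2 hg)⟩
  rcases hc.eq_or_lt with h0 | h0
  · obtain ⟨t, rfl⟩ := exists_smul_of_cross2_eq_zero h₁ h0.symm
    have ht : t < 0 := by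
      by_contra! ht
      exact hpar t ht rfl
    obtain ⟨n, hn⟩ := exists_cross2_pos h₁
    refine ⟨n, hn, ?_⟩
    rw [cross2_smul_right, cross2_swap]
    nlinarith
  · refine ⟨d₁ + d₂, ?_, ?_⟩
    · rw [cross2_add_right, cross2_self]; linarith
    · rw [cross2_add_left, cross2_self]; linarith

namespace SimplePolygon

variable (P : SimplePolygon)

/-! ### Edges and the boundary -/

instance : NeZero P.n := ⟨by have := P.three_le; omega⟩

instance : Fact (1 < P.n) := ⟨by have := P.three_le; omega⟩

/-- The `i`-th edge. -/
def edge (i : ZMod P.n) : Set E2 := segment ℝ (P.vtx i) (P.vtx (i + 1))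

theorem boundary_eq_iUnion_edge : P.boundary = ⋃ i, P.edge i := rfl

theorem mem_boundary {q : E2} : q ∈ P.boundary ↔ ∃ i, q ∈ P.edge i := by
  rw [boundary_eq_iUnion_edge, mem_iUnion]

theorem edge_subset_boundary (i : ZMod P.n) : P.edge i ⊆ P.boundary :=
  fun _ h => P.mem_boundary.2 ⟨i, h⟩

theorem isCompact_segment (a b : E2) : IsCompact (segment ℝ a b) := by
  rw [segment_eq_image_lineMap]
  exact isCompact_Icc.image AffineMap.lineMap_continuous

theorem isClosed_edge (i : ZMod P.n) : IsClosed (P.edge i) := (isCompact_segment _ _).isClosed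

theorem isCompact_boundary : IsCompact P.boundary := isCompact_iUnion fun _ => isCompact_segment _ _

theorem isClosed_boundary : IsClosed P.boundary := P.isCompact_boundary.isClosed

theorem vtx_mem_edge (i : ZMod P.n) : P.vtx i ∈ P.edge i := left_mem_segment ℝ _ _

theorem vtx_succ_mem_edge (i : ZMod P.n) : P.vtx (i + 1) ∈ P.edge i := right_mem_segment ℝ _ _

theorem vtx_mem_boundary (i : ZMod P.n) : P.vtx i ∈ P.boundary :=
  P.edge_subset_boundary i (P.vtx_mem_edge i)

theorem isPreconnected_boundary : IsPreconnected P.boundary := by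
  have h : P.boundary = ⋃ m : ℕ, P.edge (m : ZMod P.n) := by
    ext q
    rw [mem_boundary, mem_iUnion]
    constructor
    · rintro ⟨i, hi⟩
      exact ⟨i.val, by rwa [ZMod.natCast_zmod_val]⟩
    · rintro ⟨m, hm⟩
      exact ⟨_, hm⟩
  rw [h]
  refine IsPreconnected.iUnion_of_chain (fun m => (convex_segment _ _).isPreconnected) fun m => ?_
  refine ⟨P.vtx ((m : ZMod P.n) + 1), P.vtx_succ_mem_edge _, ?_⟩
  have : ((Order.succ m : ℕ) : ZMod P.n) = (m : ZMod P.n) + 1 := by simp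
  rw [this]
  exact P.vtx_mem_edge _

theorem ne_add_one (i : ZMod P.n) : i ≠ i + 1 := by
  intro h
  exact one_ne_zero (left_eq_add.1 h)

theorem vtx_ne_succ (i : ZMod P.n) : P.vtx i ≠ P.vtx (i + 1) := fun h => P.ne_add_one i (P.inj h)

theorem edge_inter_edge {j k : ZMod P.n} (hjk : j ≠ k) {q : E2} (hj : q ∈ P.edge j)
    (hk : q ∈ P.edge k) : (j + 1 = k ∧ q = P.vtx k) ∨ (k + 1 = j ∧ q = P.vtx j) := by
  have hadj : ∀ i : ZMod P.n, q ∈ P.edge i → q ∈ P.edge (i + 1) → q = P.vtx (i + 1) := by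
    intro i h1 h2
    have h3 : q ∈ ({P.vtx (i + 1)} : Set E2) := by
      rw [← P.adj_edges i]
      refine ⟨h1, ?_⟩
      have : i + 2 = i + 1 + 1 := by ring
      rw [this]
      exact h2
    exact h3
  by_cases h1 : j + 1 = k
  · subst h1
    exact Or.inl ⟨rfl, hadj j hj hk⟩
  by_cases h2 : k + 1 = j
  · subst h2
    exact Or.inr ⟨rfl, hadj k hk hj⟩
  have h3 : q ∈ (∅ : Set E2) := by
    rw [← P.nonadj_edges j k hjk h1 h2]
    exact ⟨hj, hk⟩
  exact absurd h3 (notMem_empty q)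

theorem eq_or_of_vtx_mem_edge {i j : ZMod P.n} (h : P.vtx i ∈ P.edge j) : j = i ∨ j = i - 1 := by
  by_cases hij : j = i
  · exact Or.inl hij
  rcases P.edge_inter_edge hij h (P.vtx_mem_edge i) with ⟨h1, -⟩ | ⟨-, h2⟩
  · exact Or.inr (eq_sub_of_add_eq h1)
  · exact Or.inl (P.inj h2).symm

theorem _root_.mem_segment_add_iff {q d p : E2} :
    p ∈ segment ℝ q (q + d) ↔ ∃ k : ℝ, 0 ≤ k ∧ k ≤ 1 ∧ p = q + k • d := by
  rw [segment_eq_image']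
  constructor
  · rintro ⟨k, hk, rfl⟩
    exact ⟨k, hk.1, hk.2, by simp⟩
  · rintro ⟨k, h0, h1, rfl⟩
    exact ⟨k, ⟨h0, h1⟩, by simp⟩

theorem _root_.eventually_mem_segment_iff (q : E2) {d : E2} (hd : d ≠ 0) :
    ∀ᶠ g in 𝓝 (0 : E2), (q + g ∈ segment ℝ q (q + d) ↔ ∃ k : ℝ, 0 ≤ k ∧ g = k • d) := by
  filter_upwards [Metric.ball_mem_nhds (0 : E2) (norm_pos_iff.2 hd)] with g hg
  rw [mem_segment_add_iff]
  constructor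
  · rintro ⟨k, h0, -, h⟩
    exact ⟨k, h0, add_left_cancel h⟩
  · rintro ⟨k, h0, rfl⟩
    refine ⟨k, h0, ?_, rfl⟩
    rw [mem_ball_zero_iff, norm_smul, Real.norm_of_nonneg h0] at hg
    have := norm_pos_iff.2 hd
    by_contra! hk
    nlinarith

theorem eventually_mem_boundary_iff {q d₁ d₂ : E2} (h₁ : d₁ ≠ 0) (h₂ : d₂ ≠ 0)
    (hsub : ∀ j, q ∈ P.edge j → P.edge j ⊆ segment ℝ q (q + d₁) ∪ segment ℝ q (q + d₂))
    (hsup : segment ℝ q (q + d₁) ∪ segment ℝ q (q + d₂) ⊆ P.boundary) :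
    ∀ᶠ g in 𝓝 (0 : E2),
      (q + g ∈ P.boundary ↔ (∃ k : ℝ, 0 ≤ k ∧ g = k • d₁) ∨ ∃ k : ℝ, 0 ≤ k ∧ g = k • d₂) := by
  have hfar : ∀ᶠ g in 𝓝 (0 : E2), ∀ j, q ∉ P.edge j → q + g ∉ P.edge j := by
    rw [Filter.eventually_all]
    intro j
    by_cases hj : q ∈ P.edge j
    · exact Eventually.of_forall fun g h => absurd hj h
    · have hc : Tendsto (fun g : E2 => q + g) (𝓝 0) (𝓝 q) := by
        have : Continuous (fun g : E2 => q + g) := by fun_prop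
        simpa using this.tendsto 0
      filter_upwards [hc.eventually ((P.isClosed_edge j).isOpen_compl.mem_nhds hj)] with g hg _
      exact hg
  filter_upwards [hfar, eventually_mem_segment_iff q h₁, eventually_mem_segment_iff q h₂]
    with g hg hg1 hg2
  rw [← hg1, ← hg2]
  constructor
  · intro h
    obtain ⟨j, hj⟩ := P.mem_boundary.1 h
    exact hsub j (by by_contra hn; exact hg j hn hj) hj
  · exact fun h => hsup h

theorem exists_cornerAt_boundary_of {q d₁ d₂ : E2} (h₁ : d₁ ≠ 0) (h₂ : d₂ ≠ 0)
    (hint : segment ℝ q (q + d₁) ∩ segment ℝ q (q + d₂) ⊆ {q})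
    (hsub : ∀ j, q ∈ P.edge j → P.edge j ⊆ segment ℝ q (q + d₁) ∪ segment ℝ q (q + d₂))
    (hsup : segment ℝ q (q + d₁) ∪ segment ℝ q (q + d₂) ⊆ P.boundary)
    (hc : 0 ≤ cross2 d₁ d₂) :
    ∃ r, CornerAt P.boundary q d₁ d₂ r := by
  refine exists_cornerAt h₁ ?_ hc (P.eventually_mem_boundary_iff h₁ h₂ hsub hsup)
  rintro k hk rfl
  have hk' : k ≠ 0 := fun h => h₂ (by rw [h, zero_smul])
  have hkpos : 0 < k := lt_of_le_of_ne hk hk'.symm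
  set t := min k 1 with ht
  have htpos : 0 < t := lt_min hkpos one_pos
  have hmem : q + t • d₁ ∈ ({q} : Set E2) := by
    apply hint
    constructor
    · exact mem_segment_add_iff.2 ⟨t, htpos.le, min_le_right _ _, rfl⟩
    · refine mem_segment_add_iff.2 ⟨t / k, by positivity, ?_, ?_⟩
      · rw [div_le_one hkpos]; exact min_le_left _ _
      · rw [smul_smul, div_mul_cancel₀ _ hk']
  rw [mem_singleton_iff, add_eq_left, smul_eq_zero] at hmem
  rcases hmem with h | h
  · exact htpos.ne' h
  · exact h₁ h

/-- The boundary has a corner (possibly straight) at each of its points. -/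
theorem exists_cornerAt_boundary {q : E2} (hq : q ∈ P.boundary) :
    ∃ d₁ d₂ r, CornerAt P.boundary q d₁ d₂ r ∧
      ((∃ i j j', q = P.vtx i ∧ d₁ = P.vtx j - P.vtx i ∧ d₂ = P.vtx j' - P.vtx i ∧
        ((j = i + 1 ∧ j' = i - 1) ∨ (j = i - 1 ∧ j' = i + 1))) ∨ cross2 d₁ d₂ = 0) := by
  by_cases hv : ∃ i, q = P.vtx i
  · obtain ⟨i, rfl⟩ := hv
    have hpred : i - 1 + 1 = i := sub_add_cancel i 1
    have h₁ : P.vtx (i + 1) - P.vtx i ≠ 0 := sub_ne_zero.2 (P.vtx_ne_succ i).symm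
    have h₂ : P.vtx (i - 1) - P.vtx i ≠ 0 := by
      have := P.vtx_ne_succ (i - 1)
      rw [hpred] at this
      exact sub_ne_zero.2 this
    have e₁ : segment ℝ (P.vtx i) (P.vtx i + (P.vtx (i + 1) - P.vtx i)) = P.edge i := by
      rw [add_sub_cancel]; rfl
    have e₂ : segment ℝ (P.vtx i) (P.vtx i + (P.vtx (i - 1) - P.vtx i)) = P.edge (i - 1) := by
      rw [add_sub_cancel, edge, hpred, segment_symm]
    have hint : P.edge i ∩ P.edge (i - 1) ⊆ {P.vtx i} := by
      rintro p ⟨hp1, hp2⟩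
      have hne : i - 1 ≠ i := by
        intro h
        have := P.ne_add_one (i - 1)
        rw [hpred] at this
        exact this h
      rcases P.edge_inter_edge hne hp2 hp1 with ⟨-, h⟩ | ⟨h, h'⟩
      · exact h
      · exfalso
        have h2 : ((2 : ℕ) : ZMod P.n) = 0 := by
          have : i + 1 - (i - 1) = 0 := by rw [h, sub_self]
          rw [← this]; push_cast; ring
        rw [ZMod.natCast_eq_zero_iff] at h2
        have := Nat.le_of_dvd (by norm_num) h2
        have := P.three_le
        omega
    have hsub : ∀ j, P.vtx i ∈ P.edge j → P.edge j ⊆ P.edge i ∪ P.edge (i - 1) := by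
      intro j hj
      rcases P.eq_or_of_vtx_mem_edge hj with rfl | rfl
      · exact subset_union_left
      · exact subset_union_right
    have hsup : P.edge i ∪ P.edge (i - 1) ⊆ P.boundary :=
      union_subset (P.edge_subset_boundary _) (P.edge_subset_boundary _)
    rcases le_total 0 (cross2 (P.vtx (i + 1) - P.vtx i) (P.vtx (i - 1) - P.vtx i)) with hc | hc
    · obtain ⟨r, hr⟩ := P.exists_cornerAt_boundary_of h₁ h₂ (by rwa [e₁, e₂])
        (by rwa [e₁, e₂]) (by rwa [e₁, e₂]) hc
      exact ⟨_, _, r, hr, Or.inl ⟨i, i + 1, i - 1, rfl, rfl, rfl, Or.inl ⟨rfl, rfl⟩⟩⟩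
    · obtain ⟨r, hr⟩ := P.exists_cornerAt_boundary_of h₂ h₁ (by rwa [e₁, e₂, inter_comm])
        (by rwa [e₁, e₂, union_comm]) (by rwa [e₁, e₂, union_comm])
        (by rw [cross2_swap]; linarith)
      exact ⟨_, _, r, hr, Or.inl ⟨i, i - 1, i + 1, rfl, rfl, rfl, Or.inr ⟨rfl, rfl⟩⟩⟩
  · push Not at hv
    obtain ⟨k, hk⟩ := P.mem_boundary.1 hq
    have h₁ : P.vtx k - q ≠ 0 := sub_ne_zero.2 (hv k).symm
    have h₂ : P.vtx (k + 1) - q ≠ 0 := sub_ne_zero.2 (hv (k + 1)).symm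
    have hk' := hk
    obtain ⟨a, b, ha, hb, hab, hqab⟩ := hk
    have hrel : a • (P.vtx k - q) + b • (P.vtx (k + 1) - q) = 0 := by
      obtain rfl : b = 1 - a := by linarith
      rw [← hqab]
      module
    have ha0 : a ≠ 0 := by
      rintro rfl
      rw [zero_smul, zero_add, smul_eq_zero] at hrel
      rcases hrel with h | h
      · subst h; norm_num at hab
      · exact h₂ h
    have hapos : 0 < a := lt_of_le_of_ne ha ha0.symm
    have hb0 : b ≠ 0 := by
      rintro rfl
      rw [zero_smul, add_zero, smul_eq_zero] at hrel
      rcases hrel with h | h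
      · exact ha0 h
      · exact h₁ h
    have hbpos : 0 < b := lt_of_le_of_ne hb hb0.symm
    have hc : cross2 (P.vtx k - q) (P.vtx (k + 1) - q) = 0 := by
      have := congrArg (cross2 (P.vtx k - q)) hrel
      rw [cross2_add_right, cross2_smul_right, cross2_smul_right, cross2_self,
        cross2_zero_right] at this
      simpa [hb0] using this
    have hd2 : P.vtx (k + 1) - q = (-(a / b)) • (P.vtx k - q) := by
      have h3 : b • (P.vtx (k + 1) - q) = (-a) • (P.vtx k - q) := by
        rw [neg_smul]; exact eq_neg_of_add_eq_zero_right hrel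
      rw [← inv_smul_smul₀ hb0 (P.vtx (k + 1) - q), h3, smul_smul]
      congr 1
      field_simp
    suffices hs : ∃ r, CornerAt P.boundary q (P.vtx k - q) (P.vtx (k + 1) - q) r by
      obtain ⟨r, hr⟩ := hs
      exact ⟨_, _, r, hr, Or.inr hc⟩
    refine P.exists_cornerAt_boundary_of h₁ h₂ ?_ ?_ ?_ hc.ge
    · rintro p ⟨hp1, hp2⟩
      obtain ⟨s, hs0, -, rfl⟩ := mem_segment_add_iff.1 hp1
      obtain ⟨t, ht0, -, ht⟩ := mem_segment_add_iff.1 hp2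
      have h4 : (s + t * (a / b)) • (P.vtx k - q) = 0 := by
        have := add_left_cancel ht
        rw [hd2, smul_smul] at this
        rw [add_smul, this, ← add_smul]
        ring_nf
        simp
      rw [smul_eq_zero] at h4
      rcases h4 with h4 | h4
      · have : 0 ≤ t * (a / b) := by positivity
        have : s = 0 := by linarith
        simp [this]
      · exact absurd h4 h₁
    · intro j hj
      have hjk : j = k := by
        by_contra hne
        rcases P.edge_inter_edge hne hj hk' with ⟨-, h⟩ | ⟨-, h⟩
        · exact hv _ h
        · exact hv _ h
      subst hjk
      rw [add_sub_cancel, add_sub_cancel, segment_symm ℝ q]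
      intro p hp
      obtain ⟨s, hs, rfl⟩ := (segment_eq_image_lineMap ℝ (P.vtx j) (P.vtx (j + 1))).subset hp
      have hqb : q = AffineMap.lineMap (P.vtx j) (P.vtx (j + 1)) b := by
        rw [AffineMap.lineMap_apply_module, ← hqab]
        congr 2; linarith
      rcases le_total s b with hsb | hsb
      · left
        rw [hqb, segment_eq_image_lineMap]
        refine ⟨s / b, ⟨by have := hs.1; positivity, by rwa [div_le_one hbpos]⟩, ?_⟩
        simp only [AffineMap.lineMap_apply_module']
        rw [add_sub_cancel_right, smul_smul, div_mul_cancel₀ _ hb0]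
      · right
        rw [hqb, segment_symm, segment_eq_image_lineMap]
        have hb1 : 0 < 1 - b := by linarith
        refine ⟨(1 - s) / (1 - b), ⟨div_nonneg (by linarith [hs.2]) hb1.le,
          by rw [div_le_one hb1]; linarith⟩, ?_⟩
        have hb1' := hb1.ne'
        simp only [AffineMap.lineMap_apply_module]
        ext i
        simp
        field_simp
        ring
    · rw [add_sub_cancel, add_sub_cancel]
      refine union_subset ?_ ?_
      · exact ((convex_segment _ _).segment_subset hk' (left_mem_segment ℝ _ _)).trans
          (P.edge_subset_boundary k)
      · exact ((convex_segment _ _).segment_subset hk' (right_mem_segment ℝ _ _)).trans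
          (P.edge_subset_boundary k)

end SimplePolygon

/-! ### Angles swept along paths -/

/-- `F` measures the angle swept along a path from `a` to `b` with support `G`. -/
structure IsPathAngle (F : E2 → ℝ) (G : Set E2) (a b : E2) : Prop where
  isClosed : IsClosed G
  left_mem : a ∈ G
  right_mem : b ∈ G
  continuousAt : ∀ q ∉ G, ContinuousAt F q
  coe_angle : ∀ q ∉ G, (F q : Real.Angle) =
    (toC (b - q)).arg - (toC (a - q)).arg
  far : Tendsto F (Bornology.cobounded E2) (𝓝 0)

theorem isPathAngle_viewAngle (a b : E2) :
    IsPathAngle (viewAngle a b) (segment ℝ a b) a b where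
  isClosed := (SimplePolygon.isCompact_segment a b).isClosed
  left_mem := left_mem_segment ℝ a b
  right_mem := right_mem_segment ℝ a b
  continuousAt := fun _ h => continuousAt_viewAngle h
  coe_angle := fun _ h => coe_viewAngle (fun h' => h (h' ▸ left_mem_segment ℝ a b))
    (fun h' => h (h' ▸ right_mem_segment ℝ a b))
  far := tendsto_viewAngle_cobounded a b

theorem isPathAngle_zero (a : E2) : IsPathAngle (fun _ => 0) {a} a a where
  isClosed := isClosed_singleton
  left_mem := rfl
  right_mem := rfl
  continuousAt := fun _ _ => continuousAt_const
  coe_angle := fun q _ => by simp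
  far := tendsto_const_nhds

theorem IsPathAngle.trans {F F' : E2 → ℝ} {G G' : Set E2} {a b c : E2}
    (h : IsPathAngle F G a b) (h' : IsPathAngle F' G' b c) :
    IsPathAngle (fun q => F q + F' q) (G ∪ G') a c where
  isClosed := h.isClosed.union h'.isClosed
  left_mem := Or.inl h.left_mem
  right_mem := Or.inr h'.right_mem
  continuousAt := fun q hq => by
    simp only [mem_union, not_or] at hq
    exact (h.continuousAt q hq.1).add (h'.continuousAt q hq.2)
  coe_angle := fun q hq => by
    simp only [mem_union, not_or] at hq
    rw [Real.Angle.coe_add, h.coe_angle q hq.1, h'.coe_angle q hq.2]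
    abel
  far := by simpa using h.far.add h'.far

theorem IsPathAngle.isWinding {F : E2 → ℝ} {G : Set E2} {a : E2}
    (h : IsPathAngle F G a a) : IsWinding F G where
  isClosed := h.isClosed
  continuousAt := h.continuousAt
  coe_angle := fun q hq => by rw [h.coe_angle q hq, sub_self]
  far := h.far

/-- The part of the polygonal chain `c` between indices `k` and `l`. -/
def chainSet (c : ℕ → E2) (k l : ℕ) : Set E2 :=
  {c k} ∪ ⋃ m ∈ Ico k l, segment ℝ (c m) (c (m + 1))

/-- The angle swept along the polygonal chain `c` between indices `k` and `l`. -/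
def chainAngle (c : ℕ → E2) (k l : ℕ) (q : E2) : ℝ :=
  ∑ m ∈ Finset.Ico k l, viewAngle (c m) (c (m + 1)) q

theorem mem_chainSet {c : ℕ → E2} {k l : ℕ} {q : E2} :
    q ∈ chainSet c k l ↔ q = c k ∨ ∃ m, k ≤ m ∧ m < l ∧ q ∈ segment ℝ (c m) (c (m + 1)) := by
  simp [chainSet, and_assoc]

theorem chainSet_succ (c : ℕ → E2) {k l : ℕ} (h : k ≤ l) :
    chainSet c k (l + 1) = chainSet c k l ∪ segment ℝ (c l) (c (l + 1)) := by
  ext q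
  simp only [mem_union, mem_chainSet]
  constructor
  · rintro (h1 | ⟨m, h1, h2, h3⟩)
    · exact Or.inl (Or.inl h1)
    · rcases Nat.lt_succ_iff_lt_or_eq.1 h2 with h4 | rfl
      · exact Or.inl (Or.inr ⟨m, h1, h4, h3⟩)
      · exact Or.inr h3
  · rintro ((h1 | ⟨m, h1, h2, h3⟩) | h1)
    · exact Or.inl h1
    · exact Or.inr ⟨m, h1, by omega, h3⟩
    · exact Or.inr ⟨l, h, by omega, h1⟩

theorem isPathAngle_chain (c : ℕ → E2) {k l : ℕ} (h : k ≤ l) :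
    IsPathAngle (chainAngle c k l) (chainSet c k l) (c k) (c l) := by
  induction l, h using Nat.le_induction with
  | base =>
    have h1 : chainAngle c k k = fun _ => 0 := by
      funext q; simp [chainAngle]
    have h2 : chainSet c k k = {c k} := by simp [chainSet]
    rw [h1, h2]
    exact isPathAngle_zero _
  | succ l hl ih =>
    have h1 : chainAngle c k (l + 1) =
        fun q => chainAngle c k l q + viewAngle (c l) (c (l + 1)) q := by
      funext q
      simp [chainAngle, Finset.sum_Ico_succ_top hl]
    rw [h1, chainSet_succ c hl]
    exact ih.trans (isPathAngle_viewAngle _ _)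

namespace SimplePolygon

variable (P : SimplePolygon)

/-- The vertices listed from `vtx i` on. -/
def walk (i : ZMod P.n) (m : ℕ) : E2 := P.vtx (i + m)

@[simp] theorem walk_zero (i : ZMod P.n) : P.walk i 0 = P.vtx i := by simp [walk]

@[simp] theorem walk_n (i : ZMod P.n) : P.walk i P.n = P.vtx i := by simp [walk]

theorem segment_walk (i : ZMod P.n) (m : ℕ) :
    segment ℝ (P.walk i m) (P.walk i (m + 1)) = P.edge (i + m) := by
  simp [walk, edge, add_assoc]

theorem exists_edge_eq (i j : ZMod P.n) : ∃ m < P.n, i + (m : ZMod P.n) = j :=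
  ⟨(j - i).val, ZMod.val_lt _, by rw [ZMod.natCast_zmod_val]; ring⟩

theorem chainSet_walk (i : ZMod P.n) : chainSet (P.walk i) 0 P.n = P.boundary := by
  ext q
  rw [mem_chainSet, mem_boundary]
  constructor
  · rintro (h | ⟨m, -, -, h⟩)
    · exact ⟨i, by rw [h, walk_zero]; exact P.vtx_mem_edge i⟩
    · exact ⟨_, P.segment_walk i m ▸ h⟩
  · rintro ⟨j, hj⟩
    obtain ⟨m, hm, rfl⟩ := P.exists_edge_eq i j
    exact Or.inr ⟨m, Nat.zero_le _, hm, by rwa [segment_walk]⟩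

/-- The total angle swept by the boundary, as traversed from `vtx i`. -/
def wind (i : ZMod P.n) : E2 → ℝ := chainAngle (P.walk i) 0 P.n

theorem isWinding_wind (i : ZMod P.n) : IsWinding (P.wind i) P.boundary := by
  have h := isPathAngle_chain (P.walk i) (Nat.zero_le P.n)
  rw [walk_zero, walk_n, chainSet_walk] at h
  exact h.isWinding

/-! ### Components of the complement of the boundary -/

theorem subset_component {S : Set E2} {p y : E2} (hS : IsPreconnected S)
    (hSb : Disjoint S P.boundary) (hyS : y ∈ S)
    (hy : y ∈ connectedComponentIn P.boundaryᶜ p) : S ⊆ connectedComponentIn P.boundaryᶜ p := by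
  rw [connectedComponentIn_eq hy]
  exact hS.subset_connectedComponentIn hyS fun a ha hb => disjoint_left.1 hSb ha hb

theorem boundary_subset_closure_component {p : E2} (hp : p ∉ P.boundary) :
    P.boundary ⊆ closure (connectedComponentIn P.boundaryᶜ p) := by
  set D := connectedComponentIn P.boundaryᶜ p with hD
  have hpD : p ∈ D := mem_connectedComponentIn hp
  have hDo : IsOpen D := P.isClosed_boundary.isOpen_compl.connectedComponentIn
  have hDs : D ⊆ P.boundaryᶜ := connectedComponentIn_subset _ _
  -- the frontier of a component meets the boundary
  have hsub : closure D ⊆ D ∪ P.boundary := by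
    intro q hq
    by_contra hcon
    rw [mem_union, not_or] at hcon
    have h1 : IsPreconnected (insert q D) :=
      isPreconnected_connectedComponentIn.subset_closure (subset_insert _ _)
        (insert_subset hq subset_closure)
    have h2 : insert q D ⊆ P.boundaryᶜ := insert_subset hcon.2 hDs
    exact hcon.1 (h1.subset_connectedComponentIn (mem_insert_of_mem _ hpD) h2 (mem_insert _ _))
  have hne : (P.boundary ∩ closure D).Nonempty := by
    by_contra hcon
    rw [not_nonempty_iff_eq_empty] at hcon
    have hcl : closure D ⊆ D := fun q hq => (hsub hq).elim id fun h =>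
      absurd (show q ∈ P.boundary ∩ closure D from ⟨h, hq⟩) (by rw [hcon]; exact notMem_empty q)
    have : IsClopen D := ⟨closure_subset_iff_isClosed.1 hcl, hDo⟩
    rcases isClopen_iff.1 this with h | h
    · exact (h ▸ hpD : p ∈ (∅ : Set E2))
    · exact hDs (h ▸ mem_univ (P.vtx 0)) (P.vtx_mem_boundary 0)
  have hlocal : ∀ q ∈ P.boundary, q ∈ closure D →
      ∀ᶠ q' in 𝓝[P.boundary] q, q' ∈ closure D := by
    intro q hq hqD
    obtain ⟨d₁, d₂, r, hc, -⟩ := P.exists_cornerAt_boundary hq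
    obtain ⟨y, hyD, hy⟩ := Metric.mem_closure_iff.1 hqD r hc.pos
    rw [dist_comm, dist_eq_norm] at hy
    have hev : ∀ᶠ q' in 𝓝[P.boundary] q, ‖q' - q‖ < r := by
      refine mem_nhdsWithin_of_mem_nhds ?_
      filter_upwards [Metric.ball_mem_nhds q hc.pos] with q' hq'
      rwa [Metric.mem_ball, dist_eq_norm] at hq'
    filter_upwards [hev, self_mem_nhdsWithin] with q' hq' hq'b
    obtain ⟨hn, hw⟩ := hc.mem_closure hq' hq'b
    rcases hc.mem_sector hy (hDs hyD) with h | h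
    · exact closure_mono (P.subset_component CornerAt.isPreconnected_narrow hc.disjoint_narrow h hyD) hn
    · exact closure_mono (P.subset_component hc.isPreconnected_wide hc.disjoint_wide h hyD) hw
  obtain ⟨q₀, hq₀, hq₀D⟩ := hne
  intro q hq
  have := P.isPreconnected_boundary.induction₂' (fun a b => a ∈ closure D → b ∈ closure D) ?_ ?_
    hq₀ hq
  · exact this hq₀D
  · intro a ha
    by_cases haD : a ∈ closure D
    · filter_upwards [hlocal a ha haD] with b hb
      exact ⟨fun _ => hb, fun _ => haD⟩
    · have : ∀ᶠ b in 𝓝[P.boundary] a, b ∉ closure D :=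
        mem_nhdsWithin_of_mem_nhds (isClosed_closure.isOpen_compl.mem_nhds haD)
      filter_upwards [this] with b hb
      exact ⟨fun h => absurd h haD, fun h => absurd h hb⟩
  · intro a b c _ _ _ h1 h2 h3
    exact h2 (h1 h3)

theorem sector_subset_component {p q d₁ d₂ : E2} {r : ℝ} (hp : p ∉ P.boundary)
    (hq : q ∈ P.boundary) (hc : CornerAt P.boundary q d₁ d₂ r) :
    narrowSector q d₁ d₂ r ⊆ connectedComponentIn P.boundaryᶜ p ∨
    wideSector q d₁ d₂ r ⊆ connectedComponentIn P.boundaryᶜ p := by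
  obtain ⟨y, hyD, hy⟩ :=
    Metric.mem_closure_iff.1 (P.boundary_subset_closure_component hp hq) r hc.pos
  rw [dist_comm, dist_eq_norm] at hy
  rcases hc.mem_sector hy (connectedComponentIn_subset _ _ hyD) with h | h
  · exact Or.inl (P.subset_component CornerAt.isPreconnected_narrow hc.disjoint_narrow h hyD)
  · exact Or.inr (P.subset_component hc.isPreconnected_wide hc.disjoint_wide h hyD)

theorem exists_unbounded_component :
    ∃ u, u ∉ P.boundary ∧ ¬ Bornology.IsBounded (connectedComponentIn P.boundaryᶜ u) := by
  obtain ⟨M, hM⟩ := P.isCompact_boundary.isBounded.exists_norm_le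
  obtain ⟨e, he⟩ : ∃ e : E2, ‖e‖ = 1 := ⟨EuclideanSpace.single 0 1, by simp⟩
  have hn : ∀ t : ℝ, 0 ≤ t → ‖t • e‖ = t := fun t ht => by
    rw [norm_smul, he, Real.norm_of_nonneg ht, mul_one]
  have hM0 : 0 ≤ M := (norm_nonneg _).trans (hM _ (P.vtx_mem_boundary 0))
  have hmem : ∀ t : ℝ, M < t → t • e ∈ P.boundaryᶜ := fun t ht hb => by
    have := hM _ hb
    rw [hn t (by linarith)] at this
    linarith
  have hpre : IsPreconnected ((fun t : ℝ => t • e) '' Ioi M) :=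
    isPreconnected_Ioi.image _ (by fun_prop)
  refine ⟨(M + 1) • e, hmem _ (by linarith), fun hb => ?_⟩
  have hsub : ((fun t : ℝ => t • e) '' Ioi M) ⊆ connectedComponentIn P.boundaryᶜ ((M + 1) • e) :=
    hpre.subset_connectedComponentIn ⟨M + 1, by simp, rfl⟩
      (by rintro _ ⟨t, ht, rfl⟩; exact hmem t ht)
  obtain ⟨N, hN⟩ := (hb.subset hsub).exists_norm_le
  have := hN _ ⟨max (M + 1) (N + 1), lt_of_lt_of_le (lt_add_one M) (le_max_left _ _), rfl⟩
  simp only at this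
  rw [hn _ (le_trans (by linarith) (le_max_left _ _))] at this
  linarith [le_max_right (M + 1) (N + 1)]

/-- The winding function takes different values on the two sides of an edge. -/
theorem exists_wind_ne (i : ZMod P.n) :
    ∃ p p', p ∉ P.boundary ∧ p' ∉ P.boundary ∧ P.wind i p ≠ P.wind i p' := by
  by_contra! hcon
  set q₀ := midpoint ℝ (P.vtx i) (P.vtx (i + 1)) with hq₀
  set d := P.vtx i - q₀ with hd
  have ha : P.vtx i = q₀ + d := by rw [hd]; abel
  have hb : P.vtx (i + 1) = q₀ - d := by
    have h2 : (2 : ℝ) • q₀ = P.vtx i + P.vtx (i + 1) := by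
      rw [hq₀, midpoint_eq_smul_add, smul_smul]; norm_num
    have : P.vtx (i + 1) = (2 : ℝ) • q₀ - P.vtx i := by rw [h2]; abel
    rw [this, hd, two_smul]; abel
  have hd0 : d ≠ 0 := by
    intro h
    apply P.vtx_ne_succ i
    rw [ha, hb, h]; simp
  obtain ⟨n, hn⟩ := exists_cross2_pos hd0
  have hseg : segment ℝ (P.vtx i) (P.vtx (i + 1)) = P.edge i := rfl
  have hq₀e : q₀ ∈ P.edge i := midpoint_mem_segment _ _
  have hside : ∀ t : ℝ, t ≠ 0 → q₀ + t • n ∉ P.edge i := by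
    intro t ht hmem
    rw [← hseg, ha, hb, show q₀ - d = (q₀ + d) + (-2 : ℝ) • d by rw [neg_smul, two_smul]; abel,
      mem_segment_add_iff] at hmem
    obtain ⟨k, -, -, hk⟩ := hmem
    have h1 : t • n = d + k • (-2 : ℝ) • d := by
      have := congrArg (fun v => v - q₀) hk
      simp only [add_sub_cancel_left] at this
      rw [this]; abel
    have h2 : cross2 d (t • n) = 0 := by
      rw [h1, cross2_add_right, cross2_smul_right, cross2_smul_right, cross2_self]; simp
    rw [cross2_smul_right] at h2
    exact (mul_ne_zero ht hn.ne') h2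
  have hn1 : 1 ≤ P.n := by have := P.three_le; omega
  have hrest := isPathAngle_chain (P.walk i) hn1
  have hq₀r : q₀ ∉ chainSet (P.walk i) 1 P.n := by
    have hv : ∀ j, q₀ ≠ P.vtx j := by
      intro j hj
      rcases P.eq_or_of_vtx_mem_edge (hj ▸ hq₀e) with h | h
      · rw [← h] at hj; apply hd0; rw [hd, hj, sub_self]
      · rw [show j = i + 1 by rw [h]; ring] at hj
        apply hd0
        have h' : q₀ = q₀ - d := hj.trans hb
        rwa [eq_comm, sub_eq_self] at h'
    rw [mem_chainSet]
    rintro (h | ⟨m, h1, h2, h3⟩)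
    · exact hv _ h
    · rw [segment_walk] at h3
      have hne : i ≠ i + (m : ZMod P.n) := by
        intro h
        have h4 : (m : ZMod P.n) = 0 := by simpa using h.symm
        rw [ZMod.natCast_eq_zero_iff] at h4
        exact absurd (Nat.le_of_dvd (by omega) h4) (by omega)
      rcases P.edge_inter_edge hne hq₀e h3 with ⟨_, h⟩ | ⟨_, h⟩
      · exact hv _ h
      · exact hv _ h
  have hsplit : ∀ q, P.wind i q = viewAngle (P.vtx i) (P.vtx (i + 1)) q +
      chainAngle (P.walk i) 1 P.n q := by
    intro q
    rw [wind, chainAngle, Finset.sum_eq_sum_Ico_succ_bot (by omega)]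
    simp [chainAngle, walk]
  have hbd : ∀ q, q ∉ P.edge i → q ∉ chainSet (P.walk i) 1 P.n → q ∉ P.boundary := by
    intro q h1 h2 h3
    obtain ⟨j, hj⟩ := P.mem_boundary.1 h3
    obtain ⟨m, hm, rfl⟩ := P.exists_edge_eq i j
    rcases Nat.eq_zero_or_pos m with rfl | hm0
    · exact h1 (by simpa using hj)
    · exact h2 (mem_chainSet.2 (Or.inr ⟨m, hm0, hm, by rwa [segment_walk]⟩))
  have hp : Tendsto (fun t : ℝ => q₀ + t • n) (𝓝[≠] 0) (𝓝 q₀) := by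
    refine (Continuous.tendsto' (by fun_prop) 0 q₀ (by simp)).mono_left nhdsWithin_le_nhds
  have hm : Tendsto (fun t : ℝ => q₀ + (-t) • n) (𝓝[≠] 0) (𝓝 q₀) := by
    refine (Continuous.tendsto' (by fun_prop) 0 q₀ (by simp)).mono_left nhdsWithin_le_nhds
  have hoff := hrest.isClosed.isOpen_compl.mem_nhds hq₀r
  have hlim0 : Tendsto (fun t : ℝ => (chainAngle (P.walk i) 1 P.n (q₀ + (-t) • n) -
      chainAngle (P.walk i) 1 P.n (q₀ + t • n)) / 2) (𝓝[≠] 0) (𝓝 0) := by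
    have := (((hrest.continuousAt q₀ hq₀r).tendsto.comp hm).sub
      ((hrest.continuousAt q₀ hq₀r).tendsto.comp hp)).div_const 2
    simpa using this
  have hlim : Tendsto (fun t : ℝ => viewAngle (P.vtx i) (P.vtx (i + 1)) (q₀ + t • n))
      (𝓝[≠] 0) (𝓝 0) := by
    refine hlim0.congr' ?_
    filter_upwards [hp hoff, hm hoff, self_mem_nhdsWithin] with t h1 h2 h3
    have h3 : t ≠ 0 := h3
    have h4 := hcon _ _ (hbd _ (hside t h3) h1) (hbd _ (hside (-t) (neg_ne_zero.2 h3)) h2)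
    rw [hsplit, hsplit] at h4
    have h5 : q₀ + t • n ∉ segment ℝ (q₀ + d) (q₀ - d) := by
      rw [← ha, ← hb]; exact hside t h3
    have h6 := viewAngle_reflect h5
    rw [← ha, ← hb, sub_eq_add_neg, ← neg_smul] at h6
    rw [h6] at h4
    linarith
  have hcos := (Real.continuous_cos.tendsto 0).comp hlim
  have hdC : toC d ≠ 0 := fun h => hd0 (toC_eq_zero.1 h)
  have hden : Tendsto (fun t : ℝ => toC (P.vtx i - (q₀ + t • n))) (𝓝[≠] 0) (𝓝 (toC d)) := by
    refine ((continuous_toC.comp (by fun_prop : Continuous fun t : ℝ =>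
      P.vtx i - (q₀ + t • n))).tendsto' 0 _ ?_).mono_left nhdsWithin_le_nhds
    simp [hd]
  have hnum : Tendsto (fun t : ℝ => toC (P.vtx (i + 1) - (q₀ + t • n))) (𝓝[≠] 0)
      (𝓝 (-toC d)) := by
    refine ((continuous_toC.comp (by fun_prop : Continuous fun t : ℝ =>
      P.vtx (i + 1) - (q₀ + t • n))).tendsto' 0 _ ?_).mono_left nhdsWithin_le_nhds
    simp [hb, ← toC_neg]
  have hrat := hnum.div hden hdC
  have hval : -toC d / toC d = -1 := by field_simp
  rw [hval] at hrat
  have hcos2 : Tendsto (fun t : ℝ => Real.cos (viewAngle (P.vtx i) (P.vtx (i + 1)) (q₀ + t • n)))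
      (𝓝[≠] 0) (𝓝 (-1)) := by
    have h1 := ((Complex.continuous_re.tendsto _).comp hrat).div
      ((continuous_norm.tendsto _).comp hrat) (by simp)
    have h2 : (-1 : ℂ).re / ‖(-1 : ℂ)‖ = -1 := by simp
    rw [h2] at h1
    refine h1.congr' ?_
    have hne : ∀ᶠ t in 𝓝[≠] (0 : ℝ), toC (P.vtx (i + 1) - (q₀ + t • n)) /
        toC (P.vtx i - (q₀ + t • n)) ≠ 0 := hrat.eventually_ne (by simp)
    filter_upwards [hne] with t ht
    rw [viewAngle, Complex.cos_arg ht]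
    rfl
  have h := tendsto_nhds_unique hcos2 hcos
  rw [Real.cos_zero] at h
  norm_num at h

/-- The complement of the boundary has exactly two components. -/
theorem exists_two_components : ∃ u p₀, u ∉ P.boundary ∧ p₀ ∉ P.boundary ∧
    ¬ Bornology.IsBounded (connectedComponentIn P.boundaryᶜ u) ∧
    Bornology.IsBounded (connectedComponentIn P.boundaryᶜ p₀) ∧
    (∀ p ∉ P.boundary, connectedComponentIn P.boundaryᶜ p = connectedComponentIn P.boundaryᶜ u ∨
      connectedComponentIn P.boundaryᶜ p = connectedComponentIn P.boundaryᶜ p₀) ∧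
    ∀ i, P.wind i p₀ ≠ 0 := by
  obtain ⟨u, hu, hub⟩ := P.exists_unbounded_component
  have hzero : ∀ i, ∀ p ∉ P.boundary,
      ¬ Bornology.IsBounded (connectedComponentIn P.boundaryᶜ p) → P.wind i p = 0 := by
    intro i p hp hpb
    exact (P.isWinding_wind i).eq_zero isPreconnected_connectedComponentIn
      (disjoint_left.2 fun a ha => connectedComponentIn_subset _ _ ha) hpb
      (mem_connectedComponentIn hp)
  have hconst : ∀ i, ∀ p p', p ∉ P.boundary → p' ∉ P.boundary →
      connectedComponentIn P.boundaryᶜ p = connectedComponentIn P.boundaryᶜ p' →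
      P.wind i p = P.wind i p' := by
    intro i p p' hp hp' h
    exact (P.isWinding_wind i).eq_of_isPreconnected
      (s := connectedComponentIn P.boundaryᶜ p) isPreconnected_connectedComponentIn
      (disjoint_left.2 fun a ha => connectedComponentIn_subset _ _ ha)
      (mem_connectedComponentIn hp) (h ▸ mem_connectedComponentIn hp')
  have hex : ∀ i, ∃ p ∉ P.boundary, P.wind i p ≠ 0 := by
    intro i
    obtain ⟨p, p', hp, hp', hne⟩ := P.exists_wind_ne i
    by_contra! hcon
    exact hne ((hcon p hp).trans (hcon p' hp').symm)
  obtain ⟨p₀, hp₀, hw⟩ := hex 0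
  have hb₀ : Bornology.IsBounded (connectedComponentIn P.boundaryᶜ p₀) := by
    by_contra h
    exact hw (hzero 0 p₀ hp₀ h)
  have htwo : ∀ p ∉ P.boundary,
      connectedComponentIn P.boundaryᶜ p = connectedComponentIn P.boundaryᶜ u ∨
      connectedComponentIn P.boundaryᶜ p = connectedComponentIn P.boundaryᶜ p₀ := by
    intro p hp
    obtain ⟨d₁, d₂, r, hc, -⟩ := P.exists_cornerAt_boundary (P.vtx_mem_boundary 0)
    obtain ⟨hcn, hcw⟩ := hc.mem_closure (by simpa using hc.pos) (P.vtx_mem_boundary 0)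
    obtain ⟨a, ha⟩ := closure_nonempty_iff.1 ⟨_, hcn⟩
    obtain ⟨b, hb⟩ := closure_nonempty_iff.1 ⟨_, hcw⟩
    have heq : ∀ {x y z : E2}, z ∈ connectedComponentIn P.boundaryᶜ x →
        z ∈ connectedComponentIn P.boundaryᶜ y →
        connectedComponentIn P.boundaryᶜ x = connectedComponentIn P.boundaryᶜ y :=
      fun hx hy => (connectedComponentIn_eq hx).trans (connectedComponentIn_eq hy).symm
    have hne : connectedComponentIn P.boundaryᶜ u ≠ connectedComponentIn P.boundaryᶜ p₀ :=
      fun h => hub (h ▸ hb₀)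
    rcases P.sector_subset_component hp (P.vtx_mem_boundary 0) hc with h1 | h1 <;>
    rcases P.sector_subset_component hu (P.vtx_mem_boundary 0) hc with h2 | h2 <;>
    rcases P.sector_subset_component hp₀ (P.vtx_mem_boundary 0) hc with h3 | h3
    · exact absurd (heq (h2 ha) (h3 ha)) hne
    · exact Or.inl (heq (h1 ha) (h2 ha))
    · exact Or.inr (heq (h1 ha) (h3 ha))
    · exact absurd (heq (h2 hb) (h3 hb)) hne
    · exact absurd (heq (h2 ha) (h3 ha)) hne
    · exact Or.inr (heq (h1 hb) (h3 hb))
    · exact Or.inl (heq (h1 hb) (h2 hb))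
    · exact absurd (heq (h2 hb) (h3 hb)) hne
  refine ⟨u, p₀, hu, hp₀, hub, hb₀, htwo, fun i h0 => ?_⟩
  obtain ⟨p, hp, hpw⟩ := hex i
  rcases htwo p hp with h | h
  · exact hpw ((hconst i p u hp hu h).trans (hzero i u hu hub))
  · exact hpw ((hconst i p p₀ hp hp₀ h).trans h0)

theorem exists_jordan : ∃ u p₀, u ∉ P.boundary ∧ p₀ ∉ P.boundary ∧
    P.regionᶜ = connectedComponentIn P.boundaryᶜ u ∧
    P.region \ P.boundary = connectedComponentIn P.boundaryᶜ p₀ ∧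
    ¬ Bornology.IsBounded P.regionᶜ ∧ Bornology.IsBounded (P.region \ P.boundary) ∧
    ∀ i, P.wind i p₀ ≠ 0 := by
  obtain ⟨u, p₀, hu, hp₀, hub, hb₀, htwo, hw⟩ := P.exists_two_components
  have hself : ∀ p : E2, p ∉ P.boundary → p ∈ connectedComponentIn P.boundaryᶜ p :=
    fun p hp => mem_connectedComponentIn hp
  have h1 : P.regionᶜ = connectedComponentIn P.boundaryᶜ u := by
    ext p
    simp only [region, mem_compl_iff, mem_union, Set.mem_ofPred_eq, not_or, not_and]
    constructor
    · rintro ⟨hp, hpb⟩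
      rcases htwo p hp with h | h
      · exact h ▸ hself p hp
      · exact absurd (h ▸ hb₀) (hpb hp)
    · intro hp
      refine ⟨connectedComponentIn_subset _ _ hp, fun _ => ?_⟩
      rwa [← connectedComponentIn_eq hp]
  have h2 : P.region \ P.boundary = connectedComponentIn P.boundaryᶜ p₀ := by
    ext p
    simp only [region, Set.mem_sdiff, mem_union, Set.mem_ofPred_eq]
    constructor
    · rintro ⟨h | ⟨hp, hpb⟩, hp'⟩
      · exact absurd h hp'
      · rcases htwo p hp with h | h
        · exact absurd (h ▸ hpb) hub
        · exact h ▸ hself p hp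
    · intro hp
      have hpb := connectedComponentIn_subset _ _ hp
      refine ⟨Or.inr ⟨hpb, ?_⟩, hpb⟩
      rwa [← connectedComponentIn_eq hp]
  exact ⟨u, p₀, hu, hp₀, h1, h2, h1 ▸ hub, h2 ▸ hb₀, hw⟩

theorem boundary_subset_region : P.boundary ⊆ P.region := subset_union_left

theorem isClosed_region : IsClosed P.region := by
  obtain ⟨u, p₀, hu, hp₀, h1, h2, -⟩ := P.exists_jordan
  rw [← isOpen_compl_iff, h1]
  exact P.isClosed_boundary.isOpen_compl.connectedComponentIn

theorem isPreconnected_compl_region : IsPreconnected P.regionᶜ := by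
  obtain ⟨u, p₀, hu, hp₀, h1, h2, -⟩ := P.exists_jordan
  rw [h1]
  exact isPreconnected_connectedComponentIn

theorem not_isBounded_compl_region : ¬ Bornology.IsBounded P.regionᶜ := by
  obtain ⟨u, p₀, hu, hp₀, h1, h2, h3, -⟩ := P.exists_jordan
  exact h3

theorem isBounded_region : Bornology.IsBounded P.region := by
  obtain ⟨u, p₀, hu, hp₀, h1, h2, h3, h4, -⟩ := P.exists_jordan
  exact (P.isCompact_boundary.isBounded.union h4).subset fun p hp => by
    by_cases h : p ∈ P.boundary
    · exact Or.inl h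
    · exact Or.inr ⟨hp, h⟩

theorem isPreconnected_interior : IsPreconnected (P.region \ P.boundary) := by
  obtain ⟨u, p₀, hu, hp₀, h1, h2, -⟩ := P.exists_jordan
  rw [h2]
  exact isPreconnected_connectedComponentIn

theorem isOpen_interior : IsOpen (P.region \ P.boundary) := by
  obtain ⟨u, p₀, hu, hp₀, h1, h2, -⟩ := P.exists_jordan
  rw [h2]
  exact P.isClosed_boundary.isOpen_compl.connectedComponentIn

theorem boundary_subset_closure_compl : P.boundary ⊆ closure P.regionᶜ := by
  obtain ⟨u, p₀, hu, hp₀, h1, h2, -⟩ := P.exists_jordan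
  rw [h1]
  exact P.boundary_subset_closure_component hu

theorem boundary_subset_closure_interior : P.boundary ⊆ closure (P.region \ P.boundary) := by
  obtain ⟨u, p₀, hu, hp₀, h1, h2, -⟩ := P.exists_jordan
  rw [h2]
  exact P.boundary_subset_closure_component hp₀

theorem isPreconnected_region : IsPreconnected P.region := by
  refine P.isPreconnected_interior.subset_closure sdiff_subset fun p hp => ?_
  by_cases h : p ∈ P.boundary
  · exact P.boundary_subset_closure_interior h
  · exact subset_closure ⟨hp, h⟩

/-- The winding function is a nonzero constant on the interior. -/
theorem exists_wind_eq (i : ZMod P.n) :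
    ∃ ε : ℝ, ε ≠ 0 ∧ ((ε : ℝ) : Real.Angle) = 0 ∧
      ∀ q ∈ P.region, q ∉ P.boundary → P.wind i q = ε := by
  obtain ⟨u, p₀, hu, hp₀, h1, h2, h3, h4, h5⟩ := P.exists_jordan
  refine ⟨P.wind i p₀, h5 i, (P.isWinding_wind i).coe_angle p₀ hp₀, fun q hq hqb => ?_⟩
  refine (P.isWinding_wind i).eq_of_isPreconnected P.isPreconnected_interior
    (disjoint_left.2 fun a ha => ha.2) ⟨hq, hqb⟩ ?_
  rw [h2]
  exact mem_connectedComponentIn hp₀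

end SimplePolygon

namespace SimplePolygon

variable (P : SimplePolygon)

/-! ### Local structure of the region -/

theorem subset_interior {S : Set E2} {y : E2} (hS : IsPreconnected S)
    (hSb : Disjoint S P.boundary) (hy : y ∈ S) (hyR : y ∈ P.region) :
    S ⊆ P.region \ P.boundary := by
  obtain ⟨u, p₀, hu, hp₀, h1, h2, -⟩ := P.exists_jordan
  have h3 : y ∈ P.region \ P.boundary := ⟨hyR, disjoint_left.1 hSb hy⟩
  rw [h2] at h3 ⊢
  exact P.subset_component hS hSb hy h3

theorem subset_compl_region {S : Set E2} {y : E2} (hS : IsPreconnected S)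
    (hSb : Disjoint S P.boundary) (hy : y ∈ S) (hyR : y ∉ P.region) :
    S ⊆ P.regionᶜ := by
  intro p hp hpR
  exact hyR (P.subset_interior hS hSb hp hpR hy).1

theorem exists_cone_boundary {q : E2} (hq : q ∈ P.boundary) : ∃ d₁ d₂ r,
    CornerAt P.boundary q d₁ d₂ r ∧
    ((∃ i j j', q = P.vtx i ∧ d₁ = P.vtx j - P.vtx i ∧ d₂ = P.vtx j' - P.vtx i ∧
      ((j = i + 1 ∧ j' = i - 1) ∨ (j = i - 1 ∧ j' = i + 1))) ∨ cross2 d₁ d₂ = 0) ∧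
    ((∀ g, ‖g‖ < r → (q + g ∈ P.region ↔ ¬ (0 < cross2 d₁ g ∧ 0 < cross2 g d₂))) ∨
     (∀ g, ‖g‖ < r → (q + g ∈ P.region ↔ (0 ≤ cross2 d₁ g ∧ 0 ≤ cross2 g d₂)))) := by
  obtain ⟨d₁, d₂, r, hc, hv⟩ := P.exists_cornerAt_boundary hq
  refine ⟨d₁, d₂, r, hc, hv, ?_⟩
  obtain ⟨y, hyE, hy⟩ := Metric.mem_closure_iff.1 (P.boundary_subset_closure_compl hq) r hc.pos
  obtain ⟨y', hyE', hy'⟩ :=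
    Metric.mem_closure_iff.1 (P.boundary_subset_closure_interior hq) r hc.pos
  rw [dist_comm, dist_eq_norm] at hy hy'
  have hyb : y ∉ P.boundary := fun h => hyE (P.boundary_subset_region h)
  have hn := CornerAt.isPreconnected_narrow (q := q) (d₁ := d₁) (d₂ := d₂) (r := r)
  have hw := hc.isPreconnected_wide
  have memN : ∀ g, ‖g‖ < r → (q + g ∈ narrowSector q d₁ d₂ r ↔
      (0 < cross2 d₁ g ∧ 0 < cross2 g d₂)) := by
    intro g hg
    simp [narrowSector, hg]
  have memW : ∀ g, ‖g‖ < r → (q + g ∈ wideSector q d₁ d₂ r ↔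
      ¬ (0 ≤ cross2 d₁ g ∧ 0 ≤ cross2 g d₂)) := by
    intro g hg
    simp only [wideSector, Set.mem_ofPred_eq, add_sub_cancel_left, hg, true_and, not_and_or, not_le]
  rcases hc.mem_sector hy hyb with h | h
  · left
    have hE := P.subset_compl_region hn hc.disjoint_narrow h hyE
    have hI : wideSector q d₁ d₂ r ⊆ P.region \ P.boundary := by
      rcases hc.mem_sector hy' hyE'.2 with h' | h'
      · exact absurd hyE'.1 (hE h')
      · exact P.subset_interior hw hc.disjoint_wide h' hyE'.1
    intro g hg
    rw [← memN g hg]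
    refine ⟨fun h1 h2 => hE h2 h1, fun h1 => ?_⟩
    by_cases hb : q + g ∈ P.boundary
    · exact P.boundary_subset_region hb
    · rcases hc.mem_sector (p := q + g) (by simpa using hg) hb with h2 | h2
      · exact absurd h2 h1
      · exact (hI h2).1
  · right
    have hE := P.subset_compl_region hw hc.disjoint_wide h hyE
    have hI : narrowSector q d₁ d₂ r ⊆ P.region \ P.boundary := by
      rcases hc.mem_sector hy' hyE'.2 with h' | h'
      · exact P.subset_interior hn hc.disjoint_narrow h' hyE'.1
      · exact absurd hyE'.1 (hE h')
    intro g hg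
    rw [← not_not (a := 0 ≤ cross2 d₁ g ∧ 0 ≤ cross2 g d₂), ← memW g hg]
    refine ⟨fun h1 h2 => hE h2 h1, fun h1 => ?_⟩
    by_cases hb : q + g ∈ P.boundary
    · exact P.boundary_subset_region hb
    · rcases hc.mem_sector (p := q + g) (by simpa using hg) hb with h2 | h2
      · exact (hI h2).1
      · exact absurd h2 h1

/-- Near each of its points the region is a cone. -/
theorem exists_local_cone {q : E2} (hq : q ∈ P.region) : ∃ r > 0, ∀ (g : E2) (t : ℝ),
    ‖g‖ < r → 0 < t → ‖t • g‖ < r → q + g ∈ P.region → q + t • g ∈ P.region := by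
  by_cases hb : q ∈ P.boundary
  · obtain ⟨d₁, d₂, r, hc, -, h | h⟩ := P.exists_cone_boundary hb
    · refine ⟨r, hc.pos, fun g t hg ht htg hR => ?_⟩
      rw [h _ hg] at hR
      rw [h _ htg]
      rintro ⟨h1, h2⟩
      rw [cross2_smul_right, mul_pos_iff_of_pos_left ht] at h1
      rw [cross2_smul_left, mul_pos_iff_of_pos_left ht] at h2
      exact hR ⟨h1, h2⟩
    · refine ⟨r, hc.pos, fun g t hg ht htg hR => ?_⟩
      rw [h _ hg] at hR
      rw [h _ htg, cross2_smul_right, cross2_smul_left]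
      exact ⟨mul_nonneg ht.le hR.1, mul_nonneg ht.le hR.2⟩
  · obtain ⟨r, hr, hball⟩ := Metric.isOpen_iff.1 P.isOpen_interior q ⟨hq, hb⟩
    refine ⟨r, hr, fun g t _ _ htg _ => (hball ?_).1⟩
    rw [Metric.mem_ball, dist_eq_norm]
    simpa using htg

theorem exists_local_star {q : E2} (hq : q ∈ P.region) : ∃ r > 0, ∀ q' ∈ P.region,
    ‖q' - q‖ < r → segment ℝ q q' ⊆ P.region := by
  obtain ⟨r, hr, h⟩ := P.exists_local_cone hq
  refine ⟨r, hr, fun q' hq' hn p hp => ?_⟩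
  rw [show q' = q + (q' - q) by abel, mem_segment_add_iff] at hp
  obtain ⟨k, hk0, hk1, rfl⟩ := hp
  rcases hk0.eq_or_lt with rfl | hk
  · simpa using hq
  · refine h _ k hn hk ?_ (by simpa using hq')
    rw [norm_smul, Real.norm_of_nonneg hk0]
    exact lt_of_le_of_lt (mul_le_of_le_one_left (norm_nonneg _) hk1) hn

/-- A ray entering the interior from a boundary point runs inside the region up to its
first hit with the boundary. -/
theorem exists_first_hit {z v : E2} {η : ℝ} (hz : z ∈ P.region) (hη : 0 < η)
    (h : ∀ t ∈ Ioo (0 : ℝ) η, z + t • v ∈ P.region ∧ z + t • v ∉ P.boundary) (hv : v ≠ 0) :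
    ∃ t > 0, z + t • v ∈ P.boundary ∧ (∀ s ∈ Ioo (0 : ℝ) t, z + s • v ∉ P.boundary) ∧
      segment ℝ z (z + t • v) ⊆ P.region := by
  have hcont : Continuous fun t : ℝ => z + t • v := by fun_prop
  set T : Set ℝ := Ici (η / 2) ∩ (fun t : ℝ => z + t • v) ⁻¹' P.boundary with hT
  have hTc : IsClosed T := isClosed_Ici.inter (P.isClosed_boundary.preimage hcont)
  have hTb : BddBelow T := ⟨η / 2, fun t ht => ht.1⟩
  have hhalf := h (η / 2) ⟨by linarith, by linarith⟩
  have hTn : T.Nonempty := by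
    by_contra hcon
    rw [not_nonempty_iff_eq_empty] at hcon
    have h1 : ((fun t : ℝ => z + t • v) '' Ici (η / 2)) ⊆ P.region \ P.boundary := by
      refine P.subset_interior (isPreconnected_Ici.image _ hcont.continuousOn) ?_
        ⟨η / 2, self_mem_Ici, rfl⟩ hhalf.1
      refine disjoint_left.2 ?_
      rintro _ ⟨t, ht, rfl⟩ hb
      exact (hcon ▸ (⟨ht, hb⟩ : t ∈ T) : t ∈ (∅ : Set ℝ))
    obtain ⟨N, hN⟩ := P.isBounded_region.exists_norm_le
    have hvpos : 0 < ‖v‖ := norm_pos_iff.2 hv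
    have hN0 : 0 ≤ N := (norm_nonneg _).trans (hN z hz)
    set t := max (η / 2) ((N + ‖z‖ + 1) / ‖v‖) with ht
    have h2 := hN _ (h1 ⟨t, mem_Ici.2 (le_max_left _ _), rfl⟩).1
    have h3 : ‖t • v‖ ≤ N + ‖z‖ := by
      have : t • v = (z + t • v) - z := by abel
      rw [this]
      exact (norm_sub_le _ _).trans (by simpa using h2)
    have h4 : 0 ≤ t := le_trans (by linarith) (le_max_left _ _)
    rw [norm_smul, Real.norm_of_nonneg h4] at h3
    have h5 : (N + ‖z‖ + 1) / ‖v‖ ≤ t := le_max_right _ _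
    rw [div_le_iff₀ hvpos] at h5
    linarith
  have hmem : sInf T ∈ T := hTc.csInf_mem hTn hTb
  set t := sInf T
  have ht0 : 0 < t := lt_of_lt_of_le (by linarith) hmem.1
  have hfirst : ∀ s ∈ Ioo (0 : ℝ) t, z + s • v ∉ P.boundary := by
    intro s hs hb
    by_cases hsη : s < η
    · exact (h s ⟨hs.1, hsη⟩).2 hb
    · have : s ∈ T := ⟨by rw [mem_Ici]; linarith, hb⟩
      exact absurd (csInf_le hTb this) (not_le.2 hs.2)
  refine ⟨t, ht0, hmem.2, hfirst, ?_⟩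
  have h1 : ((fun t : ℝ => z + t • v) '' Ioo 0 t) ⊆ P.region \ P.boundary := by
    have hm : 0 < min (η / 2) (t / 2) := lt_min (by linarith) (by linarith)
    refine P.subset_interior (isPreconnected_Ioo.image _ hcont.continuousOn) ?_
      ⟨min (η / 2) (t / 2), ⟨hm, lt_of_le_of_lt (min_le_right _ _) (by linarith)⟩, rfl⟩
      (h _ ⟨hm, lt_of_le_of_lt (min_le_left _ _) (by linarith)⟩).1
    refine disjoint_left.2 ?_
    rintro _ ⟨s, hs, rfl⟩ hb
    exact hfirst s hs hb
  intro p hp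
  rw [mem_segment_add_iff] at hp
  obtain ⟨k, hk0, hk1, rfl⟩ := hp
  rcases hk0.eq_or_lt with rfl | hk
  · simpa using hz
  rcases hk1.eq_or_lt with rfl | hk'
  · simpa using P.boundary_subset_region hmem.2
  · rw [smul_smul]
    exact (h1 ⟨k * t, ⟨by positivity, by nlinarith⟩, rfl⟩).1

end SimplePolygon

theorem eq_of_mem_segment_of_mem_segment {a b y q : E2} (hy : y ∈ segment ℝ a b)
    (h1 : q ∈ segment ℝ a y) (h2 : q ∈ segment ℝ y b) : q = y := by
  rw [mem_segment_iff_wbtw] at *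
  exact (wbtw_swap_left_iff ℝ b).1 ⟨hy.trans_left_right h1, h2⟩

theorem mem_segment_or_mem_segment {a b y q : E2} (hy : y ∈ segment ℝ a b)
    (hq : q ∈ segment ℝ a b) : q ∈ segment ℝ a y ∨ q ∈ segment ℝ y b := by
  have hb : b = a + (b - a) := by abel
  have hq' := hq
  rw [hb, mem_segment_add_iff] at hy hq'
  obtain ⟨t, ht, -, rfl⟩ := hy
  obtain ⟨s, hs, -, rfl⟩ := hq'
  have h := wbtw_or_wbtw_smul_vadd_of_nonneg a (b - a) hs ht
  simp only [vadd_eq_add, add_comm _ a] at h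
  rw [mem_segment_iff_wbtw] at hq
  rw [mem_segment_iff_wbtw, mem_segment_iff_wbtw]
  exact h.imp id fun h => hq.trans_left_right h

namespace SimplePolygon

variable (P : SimplePolygon)

/-! ### Separation by a chord -/

theorem exists_mem_segment_walk (i : ZMod P.n) {y : E2} (hy : y ∈ P.boundary)
    (h1 : y ∉ P.edge i) (h2 : y ∉ P.edge (i - 1)) :
    ∃ k, 0 < k ∧ k + 1 < P.n ∧ y ∈ segment ℝ (P.walk i k) (P.walk i (k + 1)) := by
  obtain ⟨j, hj⟩ := P.mem_boundary.1 hy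
  obtain ⟨m, hm, rfl⟩ := P.exists_edge_eq i j
  refine ⟨m, ?_, ?_, by rwa [segment_walk]⟩
  · rcases Nat.eq_zero_or_pos m with rfl | h
    · exact absurd (by simpa using hj) h1
    · exact h
  · by_contra hcon
    have h3 : m + 1 = P.n := by omega
    have h4 : ((m + 1 : ℕ) : ZMod P.n) = 0 := by rw [h3]; simp
    push_cast at h4
    have h5 : i + (m : ZMod P.n) = i - 1 := by linear_combination h4
    exact h2 (h5 ▸ hj)

/-- Two arcs of the boundary with the same endpoints meet only there. -/
theorem arc_inter_arc {i : ZMod P.n} {k : ℕ} (hk : k + 1 < P.n) {y q : E2}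
    (hy : y ∈ segment ℝ (P.walk i k) (P.walk i (k + 1)))
    (h1 : q ∈ chainSet (P.walk i) 0 k ∪ segment ℝ (P.walk i k) y)
    (h2 : q ∈ segment ℝ y (P.walk i (k + 1)) ∪ chainSet (P.walk i) (k + 1) P.n) :
    q = P.vtx i ∨ q = y := by
  have hsub1 : segment ℝ (P.walk i k) y ⊆ P.edge (i + k) := by
    rw [← segment_walk]
    exact (convex_segment _ _).segment_subset (left_mem_segment ℝ _ _) hy
  have hsub2 : segment ℝ y (P.walk i (k + 1)) ⊆ P.edge (i + k) := by
    rw [← segment_walk]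
    exact (convex_segment _ _).segment_subset hy (right_mem_segment ℝ _ _)
  have g1 : q = P.vtx i ∨ ∃ m ≤ k, q ∈ P.edge (i + m) ∧
      (m = k → q ∈ segment ℝ (P.walk i k) y) := by
    rcases h1 with h | h
    · rcases mem_chainSet.1 h with h | ⟨m, -, hm, h⟩
      · exact Or.inl (by simpa using h)
      · exact Or.inr ⟨m, hm.le, by rwa [← segment_walk], fun h' => by omega⟩
    · exact Or.inr ⟨k, le_rfl, hsub1 h, fun _ => h⟩
  have g2 : ∃ m, k ≤ m ∧ m < P.n ∧ q ∈ P.edge (i + m) ∧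
      (m = k → q ∈ segment ℝ y (P.walk i (k + 1))) := by
    have haux : q ∈ segment ℝ y (P.walk i (k + 1)) → ∃ m, k ≤ m ∧ m < P.n ∧ q ∈ P.edge (i + m) ∧
      (m = k → q ∈ segment ℝ y (P.walk i (k + 1))) :=
      fun h => ⟨k, le_rfl, by omega, hsub2 h, fun _ => h⟩
    rcases h2 with h | h
    · exact haux h
    · rcases mem_chainSet.1 h with h | ⟨m, hm, hm', h⟩
      · exact haux (h ▸ right_mem_segment ℝ _ _)
      · exact ⟨m, by omega, hm', by rwa [← segment_walk], fun h' => by omega⟩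
  rcases g1 with g1 | ⟨m, hm, hqm, hmk⟩
  · exact Or.inl g1
  obtain ⟨m', hm', hmn, hqm', hmk'⟩ := g2
  rcases eq_or_ne m m' with rfl | hne
  · obtain rfl : m = k := le_antisymm hm hm'
    exact Or.inr (eq_of_mem_segment_of_mem_segment hy (hmk rfl) (hmk' rfl))
  have hcast : ∀ a b : ℕ, a < P.n → b < P.n → (i + (a : ZMod P.n) = i + (b : ZMod P.n)) → a = b := by
    intro a b ha hb h
    have h' := (ZMod.natCast_eq_natCast_iff' a b P.n).1 (add_left_cancel h)
    rwa [Nat.mod_eq_of_lt ha, Nat.mod_eq_of_lt hb] at h'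
  have hlt : m < m' := by omega
  have hne' : i + (m : ZMod P.n) ≠ i + (m' : ZMod P.n) := fun h =>
    hne (hcast m m' (by omega) hmn h)
  rcases P.edge_inter_edge hne' hqm hqm' with ⟨h, hq⟩ | ⟨h, hq⟩
  · have h3 : m + 1 = m' := hcast (m + 1) m' (by omega) hmn (by push_cast; rw [← h]; ring)
    right
    rcases hm.eq_or_lt with rfl | hmlt
    · refine eq_of_mem_segment_of_mem_segment hy (hmk rfl) ?_
      rw [hq, ← h3]
      exact right_mem_segment ℝ _ _
    · obtain rfl : m' = k := by omega
      refine eq_of_mem_segment_of_mem_segment hy ?_ (hmk' rfl)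
      rw [hq]
      exact left_mem_segment ℝ _ _
  · left
    rcases Nat.lt_or_ge (m' + 1) P.n with h3 | h3
    · have := hcast (m' + 1) m h3 (by omega) (by push_cast; rw [← h]; ring)
      omega
    · have h4 : m' + 1 = P.n := by omega
      have h5 : ((m' + 1 : ℕ) : ZMod P.n) = 0 := by rw [h4]; simp
      rw [hq, ← h]
      push_cast at h5
      rw [add_assoc, h5, add_zero]

/-- A chord from the vertex `vtx i` separates the two edges at that vertex. -/
theorem exists_separation {i : ZMod P.n} {y : E2} (hy : y ∈ P.boundary) (h1 : y ∉ P.edge i)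
    (h2 : y ∉ P.edge (i - 1)) (hχ : segment ℝ (P.vtx i) y ⊆ P.region) :
    ∃ f : E2 → ℝ, ContinuousOn f (P.region \ segment ℝ (P.vtx i) y) ∧
      (∀ q ∈ P.region \ segment ℝ (P.vtx i) y, (f q : Real.Angle) = 0) ∧
      ∀ q q', q ∈ P.edge i → q' ∈ P.edge (i - 1) → q ∉ segment ℝ (P.vtx i) y →
        q' ∉ segment ℝ (P.vtx i) y → f q ≠ f q' := by
  obtain ⟨k, hk0, hkn, hyk⟩ := P.exists_mem_segment_walk i hy h1 h2
  obtain ⟨ε, hε, hεa, hW⟩ := P.exists_wind_eq i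
  set χ := segment ℝ (P.vtx i) y with hχdef
  have hχ' : segment ℝ y (P.vtx i) = χ := segment_symm ℝ _ _
  set G₁ := chainSet (P.walk i) 0 k ∪ segment ℝ (P.walk i k) y with hG₁
  set G₂ := segment ℝ y (P.walk i (k + 1)) ∪ chainSet (P.walk i) (k + 1) P.n with hG₂
  set A₁ : E2 → ℝ := fun q =>
    chainAngle (P.walk i) 0 k q + viewAngle (P.walk i k) y q + viewAngle y (P.vtx i) q with hA₁
  set A₂ : E2 → ℝ := fun q => viewAngle y (P.walk i (k + 1)) q +
    chainAngle (P.walk i) (k + 1) P.n q + viewAngle (P.vtx i) y q with hA₂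
  have w₁ : IsWinding A₁ (G₁ ∪ χ) := by
    have := ((isPathAngle_chain (P.walk i) (Nat.zero_le k)).trans
      (isPathAngle_viewAngle (P.walk i k) y)).trans (isPathAngle_viewAngle y (P.walk i 0))
    rw [walk_zero, hχ'] at this
    exact this.isWinding
  have w₂ : IsWinding A₂ (G₂ ∪ χ) := by
    have := ((isPathAngle_viewAngle y (P.walk i (k + 1))).trans
      (isPathAngle_chain (P.walk i) hkn.le)).trans (isPathAngle_viewAngle (P.walk i P.n) y)
    rw [walk_n] at this
    exact this.isWinding
  have hsub1 : segment ℝ (P.walk i k) y ⊆ P.edge (i + k) := by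
    rw [← segment_walk]
    exact (convex_segment _ _).segment_subset (left_mem_segment ℝ _ _) hyk
  have hsub2 : segment ℝ y (P.walk i (k + 1)) ⊆ P.edge (i + k) := by
    rw [← segment_walk]
    exact (convex_segment _ _).segment_subset hyk (right_mem_segment ℝ _ _)
  have hchain : ∀ a b, chainSet (P.walk i) a b ⊆ P.boundary := by
    intro a b q hq
    rcases mem_chainSet.1 hq with h | ⟨m, -, -, h⟩
    · rw [h]; exact P.vtx_mem_boundary _
    · rw [segment_walk] at h; exact P.edge_subset_boundary _ h
  have hG₁b : G₁ ⊆ P.boundary :=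
    union_subset (hchain _ _) (hsub1.trans (P.edge_subset_boundary _))
  have hG₂b : G₂ ⊆ P.boundary :=
    union_subset (hsub2.trans (P.edge_subset_boundary _)) (hchain _ _)
  have hbG : ∀ q ∈ P.boundary, q ∈ G₁ ∨ q ∈ G₂ := by
    intro q hq
    obtain ⟨j, hj⟩ := P.mem_boundary.1 hq
    obtain ⟨m, hm, rfl⟩ := P.exists_edge_eq i j
    rw [← segment_walk] at hj
    rcases lt_trichotomy m k with h | rfl | h
    · exact Or.inl (Or.inl (mem_chainSet.2 (Or.inr ⟨m, Nat.zero_le _, h, hj⟩)))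
    · exact (mem_segment_or_mem_segment hyk hj).imp Or.inr Or.inl
    · exact Or.inr (Or.inr (mem_chainSet.2 (Or.inr ⟨m, h, hm, hj⟩)))
  have hdisj : ∀ q, q ∈ G₁ → q ∈ G₂ → q ∈ χ := by
    intro q hq1 hq2
    rcases P.arc_inter_arc hkn hyk hq1 hq2 with rfl | rfl
    · exact left_mem_segment ℝ _ _
    · exact right_mem_segment ℝ _ _
  have hsum : ∀ q, q ∉ P.boundary → q ∉ χ → A₁ q + A₂ q = P.wind i q := by
    intro q hqb hqχ
    have e1 : viewAngle (P.vtx i) y q = - viewAngle y (P.vtx i) q := by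
      rw [viewAngle_swap]
      rwa [hχ']
    have hqk : q ∉ segment ℝ (P.walk i k) (P.walk i (k + 1)) := by
      rw [segment_walk]; exact fun h => hqb (P.edge_subset_boundary _ h)
    have e2 := viewAngle_add hyk hqk
    have e3 : P.wind i q = chainAngle (P.walk i) 0 k q +
        viewAngle (P.walk i k) (P.walk i (k + 1)) q + chainAngle (P.walk i) (k + 1) P.n q := by
      simp only [wind, chainAngle]
      rw [← Finset.sum_Ico_succ_top (Nat.zero_le k), Finset.sum_Ico_consecutive _ (by omega) hkn.le]
    simp only [hA₁, hA₂]
    rw [e3, e1, ← e2]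
    ring
  have hzero : ∀ {A : E2 → ℝ} {G : Set E2}, IsWinding A G → G ⊆ P.region →
      ∀ q ∈ P.boundary, q ∉ G → A q = 0 := by
    intro A G hA hG q hq hqG
    have hz : ∀ p ∈ P.regionᶜ, A p = 0 := fun p hp =>
      hA.eq_zero P.isPreconnected_compl_region
        (disjoint_left.2 fun a ha ha' => ha (hG ha')) P.not_isBounded_compl_region hp
    have hne : (𝓝[P.regionᶜ] q).NeBot :=
      mem_closure_iff_nhdsWithin_neBot.1 (P.boundary_subset_closure_compl hq)
    refine tendsto_nhds_unique ((hA.continuousAt q hqG).tendsto.mono_left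
      (nhdsWithin_le_nhds (s := P.regionᶜ))) ?_
    refine (tendsto_const_nhds (x := (0 : ℝ))).congr' ?_
    filter_upwards [self_mem_nhdsWithin] with p hp
    exact (hz p hp).symm
  have hG₁R : G₁ ∪ χ ⊆ P.region := union_subset (hG₁b.trans P.boundary_subset_region) hχ
  have hG₂R : G₂ ∪ χ ⊆ P.region := union_subset (hG₂b.trans P.boundary_subset_region) hχ
  classical
  refine ⟨fun q => if q ∈ G₂ then ε - A₁ q else A₂ q, ?_, ?_, ?_⟩
  · rintro q ⟨hqR, hqχ⟩
    by_cases hq2 : q ∈ G₂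
    · have hq1 : q ∉ G₁ ∪ χ := by
        rintro (h | h)
        · exact hqχ (hdisj q h hq2)
        · exact hqχ h
      have hc : ContinuousAt (fun q => ε - A₁ q) q :=
        continuousAt_const.sub (w₁.continuousAt q hq1)
      refine hc.continuousWithinAt.congr_of_eventuallyEq ?_ (by simp [hq2])
      have hev : ∀ᶠ p in 𝓝[P.region \ χ] q, p ∉ G₁ ∪ χ :=
        mem_nhdsWithin_of_mem_nhds (w₁.isClosed.isOpen_compl.mem_nhds hq1)
      filter_upwards [hev, self_mem_nhdsWithin] with p hp1 hpR
      by_cases hp2 : p ∈ G₂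
      · simp [hp2]
      · have hpb : p ∉ P.boundary := fun h => (hbG p h).elim (fun h => hp1 (Or.inl h)) hp2
        have := hsum p hpb hpR.2
        rw [hW p hpR.1 hpb] at this
        simp only [hp2, if_false]
        linarith
    · have hq2' : q ∉ G₂ ∪ χ := fun h => h.elim hq2 hqχ
      refine (w₂.continuousAt q hq2').continuousWithinAt.congr_of_eventuallyEq ?_ (by simp [hq2])
      have hev : ∀ᶠ p in 𝓝[P.region \ χ] q, p ∉ G₂ ∪ χ :=
        mem_nhdsWithin_of_mem_nhds (w₂.isClosed.isOpen_compl.mem_nhds hq2')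
      filter_upwards [hev] with p hp
      have hp2 : p ∉ G₂ := fun h => hp (Or.inl h)
      simp [hp2]
  · rintro q ⟨hqR, hqχ⟩
    by_cases hq2 : q ∈ G₂
    · have hq1 : q ∉ G₁ ∪ χ := by
        rintro (h | h)
        · exact hqχ (hdisj q h hq2)
        · exact hqχ h
      simp only [hq2, if_true]
      rw [Real.Angle.coe_sub, hεa, w₁.coe_angle q hq1, sub_zero]
    · have hq2' : q ∉ G₂ ∪ χ := fun h => h.elim hq2 hqχ
      simp only [hq2, if_false]
      exact w₂.coe_angle q hq2'
  · intro q q' hq hq' hqχ hq'χ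
    have hqG : q ∈ G₁ := by
      refine Or.inl (mem_chainSet.2 (Or.inr ⟨0, le_rfl, hk0, ?_⟩))
      rw [segment_walk]; simpa using hq
    have hqG' : q' ∈ G₂ := by
      refine Or.inr (mem_chainSet.2 (Or.inr ⟨P.n - 1, by omega, by omega, ?_⟩))
      rw [segment_walk]
      have : ((P.n - 1 : ℕ) : ZMod P.n) = -1 := by
        rw [Nat.cast_sub (by omega)]; simp
      rwa [this, ← sub_eq_add_neg]
    have hq2 : q ∉ G₂ := fun h => hqχ (hdisj q hqG h)
    have hq1 : q' ∉ G₁ := fun h => hq'χ (hdisj q' h hqG')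
    simp only [hq2, if_false, hqG', if_true]
    rw [hzero w₂ hG₂R q (hG₁b hqG) (fun h => h.elim hq2 hqχ),
      hzero w₁ hG₁R q' (hG₂b hqG') (fun h => h.elim hq1 hq'χ), sub_zero]
    exact hε.symm

end SimplePolygon

namespace SimplePolygon

variable (P : SimplePolygon)

/-! ### Leaving the visible part of the region -/

/-- The set of points visible from `x`. -/
def visSet (x : E2) : Set E2 := {q | segment ℝ x q ⊆ P.region}

theorem mem_visSet_iff {x q : E2} :
    q ∈ P.visSet x ↔ ∀ t ∈ Icc (0 : ℝ) 1, x + t • (q - x) ∈ P.region := by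
  have h : q = x + (q - x) := by abel
  constructor
  · intro hq t ht
    refine hq ?_
    rw [h, mem_segment_add_iff]
    exact ⟨t, ht.1, ht.2, by simp⟩
  · intro hq p hp
    rw [h, mem_segment_add_iff] at hp
    obtain ⟨t, h0, h1, rfl⟩ := hp
    exact hq t ⟨h0, h1⟩

theorem isClosed_visSet (x : E2) : IsClosed (P.visSet x) := by
  have : P.visSet x = ⋂ t ∈ Icc (0 : ℝ) 1, (fun q => x + t • (q - x)) ⁻¹' P.region := by
    ext q
    simp only [mem_visSet_iff, mem_iInter, mem_preimage]
  rw [this]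
  exact isClosed_biInter fun t _ => P.isClosed_region.preimage (by fun_prop)

/-- A component of the invisible part of the region can be left along a segment that ends at
a visible point. -/
theorem exists_escape {x p : E2} (hx : x ∈ P.region) (hp : p ∈ P.region) (hpS : p ∉ P.visSet x) :
    ∃ s d, s ∈ P.visSet x ∧ ∀ t ∈ Ioc (0 : ℝ) 1,
      s + t • d ∈ connectedComponentIn (P.region \ P.visSet x) p := by
  by_contra! hcon
  set K := connectedComponentIn (P.region \ P.visSet x) p with hK
  have hKs : K ⊆ P.region \ P.visSet x := connectedComponentIn_subset _ _
  have hpK : p ∈ K := mem_connectedComponentIn ⟨hp, hpS⟩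
  have hKmem : ∀ {S : Set E2} {q : E2}, IsPreconnected S → S ⊆ P.region \ P.visSet x → q ∈ S →
      q ∈ K → S ⊆ K := by
    intro S q hS hSs hq hqK
    rw [hK, connectedComponentIn_eq hqK]
    exact hS.subset_connectedComponentIn hq hSs
  have step : ∀ q q', segment ℝ q q' ⊆ P.region → q ∈ K → q' ∈ K := by
    intro q q' hseg hqK
    have hcont : Continuous fun t : ℝ => q + t • (q' - q) := by fun_prop
    have hR : ∀ t ∈ Icc (0 : ℝ) 1, q + t • (q' - q) ∈ P.region := by
      intro t ht
      refine hseg ?_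
      rw [show q' = q + (q' - q) by abel, mem_segment_add_iff]
      exact ⟨t, ht.1, ht.2, by simp⟩
    set T : Set ℝ := Icc 0 1 ∩ (fun t : ℝ => q + t • (q' - q)) ⁻¹' P.visSet x with hT
    have hTc : IsClosed T := isClosed_Icc.inter ((P.isClosed_visSet x).preimage hcont)
    have hTb : BddBelow T := ⟨0, fun t ht => ht.1.1⟩
    rcases T.eq_empty_or_nonempty with hTe | hTn
    · have h1 : ((fun t : ℝ => q + t • (q' - q)) '' Icc 0 1) ⊆ K := by
        refine hKmem (isPreconnected_Icc.image _ hcont.continuousOn) ?_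
          ⟨0, by simp, by simp⟩ hqK
        rintro _ ⟨t, ht, rfl⟩
        exact ⟨hR t ht, fun h => (hTe ▸ (⟨ht, h⟩ : t ∈ T) : t ∈ (∅ : Set ℝ))⟩
      exact h1 ⟨1, by simp, by simp⟩
    · exfalso
      have hmem : sInf T ∈ T := hTc.csInf_mem hTn hTb
      set t₀ := sInf T
      have h0 : 0 < t₀ := by
        refine lt_of_le_of_ne hmem.1.1 fun h => ?_
        have := hmem.2
        rw [← h] at this
        exact (hKs hqK).2 (by simpa using this)
      have h1 : ((fun t : ℝ => q + t • (q' - q)) '' Ico 0 t₀) ⊆ K := by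
        refine hKmem (isPreconnected_Ico.image _ hcont.continuousOn) ?_
          ⟨0, by simpa using h0, by simp⟩ hqK
        rintro _ ⟨t, ht, rfl⟩
        have ht1 : t ∈ Icc (0 : ℝ) 1 := ⟨ht.1, ht.2.le.trans hmem.1.2⟩
        exact ⟨hR t ht1, fun h =>
          absurd (csInf_le hTb (⟨ht1, h⟩ : t ∈ T)) (not_le.2 ht.2)⟩
      obtain ⟨t, ht, hn⟩ := hcon (q + t₀ • (q' - q)) (-t₀ • (q' - q)) hmem.2
      refine hn (h1 ⟨t₀ - t * t₀, ⟨?_, ?_⟩, ?_⟩)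
      · nlinarith [ht.2]
      · nlinarith [ht.1]
      · simp only [smul_smul, add_assoc, ← add_smul]
        ring_nf
  have hxK : x ∈ K := by
    refine P.isPreconnected_region.induction₂' (fun a b => a ∈ K → b ∈ K) ?_ ?_ hp hx hpK
    · intro a ha
      obtain ⟨r, hr, hstar⟩ := P.exists_local_star ha
      filter_upwards [mem_nhdsWithin_of_mem_nhds (Metric.ball_mem_nhds a hr),
        self_mem_nhdsWithin] with b hb hbR
      rw [Metric.mem_ball, dist_eq_norm] at hb
      have h := hstar b hbR hb
      exact ⟨step a b h, step b a (segment_symm ℝ a b ▸ h)⟩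
    · intro a b c _ _ _ h1 h2 h3
      exact h2 (h1 h3)
  refine (hKs hxK).2 ?_
  intro q hq
  rw [segment_same, mem_singleton_iff] at hq
  rwa [hq]

/-- A reflex corner, oriented by the sign `σ`: the exterior lies between the edge towards
`vtx j'` and the edge towards `vtx j`. -/
structure ReflexCorner (σ : ℝ) (i j j' : ZMod P.n) (r : ℝ) : Prop where
  sign : σ = 1 ∨ σ = -1
  adj : (j = i + 1 ∧ j' = i - 1) ∨ (j = i - 1 ∧ j' = i + 1)
  pos : 0 < r
  cross_pos : 0 < σ * cross2 (P.vtx j' - P.vtx i) (P.vtx j - P.vtx i)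
  mem_boundary_iff : ∀ g, ‖g‖ < r → (P.vtx i + g ∈ P.boundary ↔
    (∃ k : ℝ, 0 ≤ k ∧ g = k • (P.vtx j - P.vtx i)) ∨ ∃ k : ℝ, 0 ≤ k ∧ g = k • (P.vtx j' - P.vtx i))
  mem_region_iff : ∀ g, ‖g‖ < r → (P.vtx i + g ∈ P.region ↔
    ¬ (0 < σ * cross2 (P.vtx j' - P.vtx i) g ∧ 0 < σ * cross2 g (P.vtx j - P.vtx i)))

variable {P}

/-- A boundary point near which the region is not convex is a reflex vertex. -/
theorem exists_reflexCorner {z : E2} {σ : ℝ} {Q : E2 → E2 → Prop} (hσ : σ = 1 ∨ σ = -1)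
    (hz : z ∈ P.boundary)
    (h : ∀ r > 0, ∃ g₁ g₂ : E2, ∃ κ₁ κ₂ : ℝ, ‖g₁‖ < r ∧ ‖g₂‖ < r ∧ ‖κ₁ • g₁ + κ₂ • g₂‖ < r ∧
      0 ≤ κ₁ ∧ 0 ≤ κ₂ ∧ z + g₁ ∈ P.region ∧ z + g₂ ∈ P.region ∧
      z + (κ₁ • g₁ + κ₂ • g₂) ∉ P.region ∧ Q g₁ g₂) :
    ∃ i j j' r, z = P.vtx i ∧ P.ReflexCorner σ i j j' r ∧
      ∃ g₁ g₂ : E2, ∃ κ₁ κ₂ : ℝ, ‖g₁‖ < r ∧ ‖g₂‖ < r ∧ ‖κ₁ • g₁ + κ₂ • g₂‖ < r ∧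
      0 ≤ κ₁ ∧ 0 ≤ κ₂ ∧ z + g₁ ∈ P.region ∧ z + g₂ ∈ P.region ∧
      z + (κ₁ • g₁ + κ₂ • g₂) ∉ P.region ∧ Q g₁ g₂ := by
  obtain ⟨d₁, d₂, r, hc, hv, hR⟩ := P.exists_cone_boundary hz
  have hall := h r hc.pos
  obtain ⟨g₁, g₂, κ₁, κ₂, n1, n2, n3, hκ₁, hκ₂, m1, m2, m3, -⟩ := h r hc.pos
  have lin1 : cross2 d₁ (κ₁ • g₁ + κ₂ • g₂) = κ₁ * cross2 d₁ g₁ + κ₂ * cross2 d₁ g₂ := by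
    rw [cross2_add_right, cross2_smul_right, cross2_smul_right]
  have lin2 : cross2 (κ₁ • g₁ + κ₂ • g₂) d₂ = κ₁ * cross2 g₁ d₂ + κ₂ * cross2 g₂ d₂ := by
    rw [cross2_add_left, cross2_smul_left, cross2_smul_left]
  rcases hR with hR | hR
  swap
  · exfalso
    rw [hR _ n1] at m1
    rw [hR _ n2] at m2
    rw [hR _ n3, lin1, lin2] at m3
    exact m3 ⟨add_nonneg (mul_nonneg hκ₁ m1.1) (mul_nonneg hκ₂ m2.1),
      add_nonneg (mul_nonneg hκ₁ m1.2) (mul_nonneg hκ₂ m2.2)⟩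
  by_cases hcr : cross2 d₁ d₂ = 0
  · exfalso
    obtain ⟨t, ht, hd₂⟩ := hc.neg_of_cross_eq_zero hcr
    have hEq : ∀ g, cross2 g d₂ = -t * cross2 d₁ g := by
      intro g
      rw [hd₂, cross2_smul_right, cross2_swap]; ring
    have hiff : ∀ g, (¬ (0 < cross2 d₁ g ∧ 0 < cross2 g d₂)) ↔ cross2 d₁ g ≤ 0 := by
      intro g
      rw [hEq g, ← not_lt, not_iff_not]
      exact ⟨fun h => h.1, fun h => ⟨h, mul_pos (by linarith) h⟩⟩
    rw [hR _ n1, hiff] at m1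
    rw [hR _ n2, hiff] at m2
    rw [hR _ n3, hiff, lin1] at m3
    exact m3 (add_nonpos (mul_nonpos_of_nonneg_of_nonpos hκ₁ m1)
      (mul_nonpos_of_nonneg_of_nonpos hκ₂ m2))
  have hpos : 0 < cross2 d₁ d₂ := lt_of_le_of_ne hc.cross_nonneg (Ne.symm hcr)
  obtain ⟨i, j, j', rfl, rfl, rfl, hadj⟩ := hv.resolve_right hcr
  rcases hσ with rfl | rfl
  · refine ⟨i, j', j, r, rfl, ⟨Or.inl rfl, ?_, hc.pos, by simpa using hpos, ?_, ?_⟩, hall⟩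
    · tauto
    · intro g hg
      rw [hc.mem_iff g hg, or_comm]
    · intro g hg
      simpa using hR g hg
  · refine ⟨i, j, j', r, rfl, ⟨Or.inr rfl, hadj, hc.pos, ?_, ?_, ?_⟩, hall⟩
    · rw [cross2_swap]; linarith
    · intro g hg
      rw [hc.mem_iff g hg]
    · intro g hg
      rw [hR g hg, cross2_swap g, cross2_swap (P.vtx j - P.vtx i) g, and_comm]
      simp

end SimplePolygon

/-- If a cone spanned by `-e` and `g` enters the sector between `b` and `a`, while `-e` and `g`
do not belong to it, then it crosses the sector from `b` to `a`. -/
theorem sector_crossing {σ c κ₁ κ₂ : ℝ} {a b e g : E2} (hσ : σ = 1 ∨ σ = -1) (hc : 0 < c)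
    (hκ₁ : 0 ≤ κ₁) (hκ₂ : 0 ≤ κ₂) (hba : 0 < σ * cross2 b a) (heg : 0 < σ * cross2 e g)
    (h1 : ¬ (0 < σ * cross2 b (-c • e) ∧ 0 < σ * cross2 (-c • e) a))
    (h2 : ¬ (0 < σ * cross2 b g ∧ 0 < σ * cross2 g a))
    (h3 : 0 < σ * cross2 b (κ₁ • -c • e + κ₂ • g) ∧ 0 < σ * cross2 (κ₁ • -c • e + κ₂ • g) a) :
    0 ≤ σ * cross2 e a ∧ 0 < σ * cross2 e b ∧ σ * cross2 b g ≤ 0 := by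
  have hp := cross2_plucker e g b a
  have hs : σ * σ = 1 := by rcases hσ with rfl | rfl <;> norm_num
  simp only [cross2_add_right, cross2_add_left, cross2_smul_right, cross2_smul_left,
    cross2_swap b e] at h1 h3
  rw [cross2_swap g b] at hp
  obtain ⟨h3, h4⟩ := h3
  set A := σ * cross2 e a with hA
  set B := σ * cross2 e b with hB
  set U := σ * cross2 b g with hU
  set V := σ * cross2 g a with hV
  set X := σ * cross2 b a
  set Y := σ * cross2 e g
  have hp' : Y * X - B * V - A * U = 0 := by
    simp only [hA, hB, hU, hV, X, Y]
    linear_combination (σ * σ) * hp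
  have h1' : ¬ (0 < c * B ∧ 0 < -(c * A)) := by
    simp only [hA, hB]
    convert h1 using 3 <;> ring
  have h3' : 0 < κ₁ * (c * B) + κ₂ * U := by
    simp only [hB, hU]
    convert h3 using 1; ring
  have h4' : 0 < -(κ₁ * (c * A)) + κ₂ * V := by
    simp only [hA, hV]
    convert h4 using 1; ring
  have hB0 : 0 < B := by
    by_contra hB
    have hB : B ≤ 0 := not_lt.1 hB
    have hU0 : 0 < U := by
      by_contra hU
      have hU : U ≤ 0 := not_lt.1 hU
      have := mul_nonneg hκ₁ (mul_nonneg hc.le (neg_nonneg.2 hB))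
      have := mul_nonneg hκ₂ (neg_nonneg.2 hU)
      linarith
    have hV0 : V ≤ 0 := not_lt.1 fun h => h2 ⟨hU0, h⟩
    have hA0 : A < 0 := by
      by_contra hA
      have hA : 0 ≤ A := not_lt.1 hA
      have := mul_nonneg hκ₁ (mul_nonneg hc.le hA)
      have := mul_nonneg hκ₂ (neg_nonneg.2 hV0)
      linarith
    have k1 : 0 ≤ κ₂ * (Y * X) := by positivity
    have k2 : 0 ≤ (-B) * (-(κ₁ * (c * A)) + κ₂ * V) := mul_nonneg (by linarith) h4'.le
    have k3 : 0 < (-A) * (κ₁ * (c * B) + κ₂ * U) := mul_pos (by linarith) h3'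
    nlinarith [congrArg (fun w => κ₂ * w) hp']
  have hA0 : 0 ≤ A := by
    by_contra hA
    exact h1' ⟨mul_pos hc hB0, by rw [← mul_neg]; exact mul_pos hc (by linarith)⟩
  refine ⟨hA0, hB0, ?_⟩
  have hV0 : 0 < V := by
    by_contra hV
    have := mul_nonneg hκ₁ (mul_nonneg hc.le hA0)
    have := mul_nonneg hκ₂ (neg_nonneg.2 (not_lt.1 hV))
    linarith
  exact not_lt.1 fun h => h2 ⟨h, hV0⟩

namespace SimplePolygon

variable {P : SimplePolygon}

/-- If visibility from `x` is lost when leaving the segment from `x` to `x + e` in direction `d`,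
then it is obstructed by a reflex vertex on that segment. -/
theorem exists_reflex_view {x e d : E2} {σ : ℝ} (hσ : σ = 1 ∨ σ = -1)
    (hxs : ∀ l ∈ Icc (0 : ℝ) 1, x + l • e ∈ P.region)
    (hd : ∀ t ∈ Ioc (0 : ℝ) 1, x + (e + t • d) ∈ P.region)
    (hS : ∀ t ∈ Ioc (0 : ℝ) 1, x + (e + t • d) ∉ P.visSet x) (hpos : 0 < σ * cross2 e d) :
    ∃ i j j' r, ∃ l : ℝ, P.ReflexCorner σ i j j' r ∧ 0 < l ∧ l ≤ 1 ∧ P.vtx i = x + l • e ∧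
      0 ≤ σ * cross2 e (P.vtx j - P.vtx i) ∧ 0 < σ * cross2 e (P.vtx j' - P.vtx i) ∧
      ∃ g, ‖g‖ < r ∧ σ * cross2 (P.vtx j' - P.vtx i) g ≤ 0 ∧ 0 < σ * cross2 e g ∧
      ∃ T, IsPreconnected T ∧ T ⊆ P.region ∧ P.vtx i + g ∈ T ∧
        (∃ t ∈ Ioc (0 : ℝ) 1, x + (e + t • d) ∈ T) ∧ ∀ q ∈ T, 0 < σ * cross2 e (q - P.vtx i) := by
  have hx : x ∈ P.region := by simpa using hxs 0 (by simp)
  set Good : ℝ → ℝ → Prop := fun l τ₀ => 0 < τ₀ ∧ τ₀ ≤ 1 ∧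
    ∀ l' ∈ Icc l 1, ∀ τ ∈ Ioc 0 τ₀, x + l' • (e + τ • d) ∈ P.region with hGood
  set L : Set ℝ := {l | l ∈ Icc (0 : ℝ) 1 ∧ ∃ τ₀, Good l τ₀} with hL
  have h1L : (1 : ℝ) ∈ L := by
    refine ⟨by simp, 1, one_pos, le_rfl, fun l' hl' τ hτ => ?_⟩
    obtain rfl : l' = 1 := le_antisymm hl'.2 hl'.1
    rw [one_smul]
    exact hd τ hτ
  have h0L : (0 : ℝ) ∉ L := by
    rintro ⟨-, τ₀, h0, h1, h⟩
    refine hS τ₀ ⟨h0, h1⟩ (P.mem_visSet_iff.2 fun t ht => ?_)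
    rw [add_sub_cancel_left]
    exact h t ht τ₀ ⟨h0, le_rfl⟩
  have hLb : BddBelow L := ⟨0, fun l hl => hl.1.1⟩
  set l₀ := sInf L with hl₀
  have hl₀0 : 0 ≤ l₀ := le_csInf ⟨1, h1L⟩ fun l hl => hl.1.1
  have hl₀1 : l₀ ≤ 1 := csInf_le hLb h1L
  have hnear : ∀ δ > 0, ∃ l ∈ L, l₀ ≤ l ∧ l < l₀ + δ := by
    intro δ hδ
    obtain ⟨l, hl, hlt⟩ := exists_lt_of_csInf_lt ⟨1, h1L⟩ (show sInf L < l₀ + δ by linarith)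
    exact ⟨l, hl, csInf_le hLb hl, hlt⟩
  have hup : ∀ l ∈ L, ∀ l', l ≤ l' → l' ≤ 1 → l' ∈ L := by
    rintro l ⟨hl, τ₀, h0, h1, h⟩ l' hll' hl'
    exact ⟨⟨hl.1.trans hll', hl'⟩, τ₀, h0, h1, fun m hm => h m ⟨hll'.trans hm.1, hm.2⟩⟩
  have hbad : ∀ δ > 0, ∃ l ∈ Icc (0 : ℝ) 1, |l - l₀| < δ ∧ ∃ τ ∈ Ioo (0 : ℝ) δ,
      x + l • (e + τ • d) ∉ P.region := by
    intro δ hδ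
    by_contra! hcon
    obtain ⟨l₁, ⟨hl₁, τ₁, h0, h1, h⟩, hge, hlt⟩ := hnear δ hδ
    have hmem : max 0 (l₀ - δ / 2) ∈ L := by
      refine ⟨⟨le_max_left _ _, max_le zero_le_one (by linarith)⟩, min τ₁ (δ / 2),
        lt_min h0 (by linarith), (min_le_left _ _).trans h1, fun l' hl' τ hτ => ?_⟩
      have e1 := (le_max_left _ _).trans hl'.1
      have e2 := (le_max_right _ _).trans hl'.1
      rcases le_or_gt l₁ l' with hle | hgt
      · exact h l' ⟨hle, hl'.2⟩ τ ⟨hτ.1, hτ.2.trans (min_le_left _ _)⟩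
      · refine hcon l' ⟨e1, hl'.2⟩ ?_ τ ⟨hτ.1, ?_⟩
        · rw [abs_lt]; constructor <;> linarith
        · have := hτ.2.trans (min_le_right _ _); linarith
    have hle : l₀ ≤ max 0 (l₀ - δ / 2) := csInf_le hLb hmem
    rcases le_max_iff.1 hle with h' | h'
    · have : max 0 (l₀ - δ / 2) = 0 := max_eq_left (by linarith)
      exact h0L (this ▸ hmem)
    · linarith
  have hN : 0 < ‖e‖ + ‖d‖ + 1 := by positivity
  have hnorm : ∀ {u w δ r : ℝ}, |u| < δ → |w| < δ → δ * (‖e‖ + ‖d‖ + 1) ≤ r →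
      ‖u • e + w • d‖ < r := by
    intro u w δ r hu hw hr
    have h1 : ‖u • e + w • d‖ ≤ |u| * ‖e‖ + |w| * ‖d‖ := by
      refine (norm_add_le _ _).trans ?_
      rw [norm_smul, norm_smul, Real.norm_eq_abs, Real.norm_eq_abs]
    have hδ : 0 < δ := (abs_nonneg u).trans_lt hu
    have h2 := mul_le_mul_of_nonneg_right hu.le (norm_nonneg e)
    have h3 := mul_le_mul_of_nonneg_right hw.le (norm_nonneg d)
    nlinarith
  have hexp : ∀ l τ : ℝ, x + l • (e + τ • d) = x + l₀ • e + ((l - l₀) • e + (l * τ) • d) := by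
    intro l τ
    rw [smul_add, smul_smul, sub_smul]; abel
  have hlτ : ∀ {l τ δ : ℝ}, l ∈ Icc (0 : ℝ) 1 → τ ∈ Ioo (0 : ℝ) δ → |l * τ| < δ := by
    intro l τ δ hl hτ
    rw [abs_of_nonneg (mul_nonneg hl.1 hτ.1.le)]
    nlinarith [hl.2, hτ.1, hτ.2, hl.1]
  have hl₀pos : 0 < l₀ := by
    refine lt_of_le_of_ne hl₀0 fun h => ?_
    obtain ⟨r, hr, hcone⟩ := P.exists_local_cone hx
    set δ := r / (‖e‖ + ‖d‖ + 1) with hδ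
    have hδ0 : 0 < δ := div_pos hr hN
    have hδr : δ * (‖e‖ + ‖d‖ + 1) ≤ r := by rw [hδ, div_mul_cancel₀ _ hN.ne']
    obtain ⟨l₁, hl₁, hge, hlt⟩ := hnear δ hδ0
    have hl₁0 : 0 < l₁ := lt_of_le_of_ne (h ▸ hge) fun h' => h0L (h' ▸ hl₁)
    obtain ⟨hl₁I, τ₁, h0, h1, hg⟩ := hl₁
    obtain ⟨l, hl, hll, τ, hτ, hnR⟩ := hbad (min δ τ₁) (lt_min hδ0 h0)
    have hτδ : τ ∈ Ioo (0 : ℝ) δ := ⟨hτ.1, hτ.2.trans_le (min_le_left _ _)⟩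
    have hτ1 : τ ∈ Ioc (0 : ℝ) τ₁ := ⟨hτ.1, (hτ.2.trans_le (min_le_right _ _)).le⟩
    have hlpos : 0 < l := by
      refine lt_of_le_of_ne hl.1 fun h' => hnR ?_
      rw [← h']; simpa using hx
    have n1 : ‖l₁ • (e + τ • d)‖ < r := by
      rw [smul_add, smul_smul]
      refine hnorm (δ := δ) ?_ (hlτ hl₁I hτδ) hδr
      rw [abs_of_pos hl₁0]; linarith
    have heq : (l / l₁) • l₁ • (e + τ • d) = l • (e + τ • d) := by
      rw [smul_smul, div_mul_cancel₀ _ hl₁0.ne']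
    have n2 : ‖(l / l₁) • l₁ • (e + τ • d)‖ < r := by
      rw [heq, smul_add, smul_smul]
      refine hnorm (δ := δ) ?_ (hlτ hl hτδ) hδr
      rw [← h, sub_zero] at hll
      exact hll.trans_le (min_le_left _ _)
    have := hcone _ _ n1 (div_pos hlpos hl₁0) n2 (hg l₁ ⟨le_rfl, hl₁I.2⟩ τ hτ1)
    rw [heq] at this
    exact hnR this
  set z := x + l₀ • e with hz
  have hzR : z ∈ P.region := hxs l₀ ⟨hl₀0, hl₀1⟩
  have hzb : z ∈ P.boundary := by
    by_contra hb
    obtain ⟨r, hr, hball⟩ := Metric.isOpen_iff.1 P.isOpen_interior z ⟨hzR, hb⟩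
    obtain ⟨l, hl, hll, τ, hτ, hnR⟩ := hbad (r / (‖e‖ + ‖d‖ + 1)) (div_pos hr hN)
    rw [hexp] at hnR
    refine hnR (hball ?_).1
    rw [Metric.mem_ball, dist_eq_norm, add_sub_cancel_left]
    exact hnorm hll (hlτ hl hτ) (by rw [div_mul_cancel₀ _ hN.ne'])
  have key : ∀ r > 0, ∃ g₁ g₂ : E2, ∃ κ₁ κ₂ : ℝ,
      ‖g₁‖ < r ∧ ‖g₂‖ < r ∧ ‖κ₁ • g₁ + κ₂ • g₂‖ < r ∧
      0 ≤ κ₁ ∧ 0 ≤ κ₂ ∧ z + g₁ ∈ P.region ∧ z + g₂ ∈ P.region ∧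
      z + (κ₁ • g₁ + κ₂ • g₂) ∉ P.region ∧ ((∃ c : ℝ, 0 < c ∧ g₁ = -c • e) ∧
        0 < σ * cross2 e g₂ ∧ ∃ T, IsPreconnected T ∧ T ⊆ P.region ∧ z + g₂ ∈ T ∧
        (∃ t ∈ Ioc (0 : ℝ) 1, x + (e + t • d) ∈ T) ∧ ∀ q ∈ T, 0 < σ * cross2 e (q - z)) := by
    intro r hr
    set δ := r / (‖e‖ + ‖d‖ + 1) with hδ
    have hδ0 : 0 < δ := div_pos hr hN
    have hδr : δ * (‖e‖ + ‖d‖ + 1) ≤ r := by rw [hδ, div_mul_cancel₀ _ hN.ne']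
    obtain ⟨l, hl, hll, τ', hτ', hnR⟩ := hbad δ hδ0
    obtain ⟨l₁, hl₁, hge, hlt, hor⟩ : ∃ l₁ ∈ L, l₀ ≤ l₁ ∧ l₁ < l₀ + δ ∧ (l ≤ l₀ ∨ l₁ = l) := by
      rcases le_or_gt l l₀ with h | h
      · obtain ⟨l₁, h1, h2, h3⟩ := hnear δ hδ0
        exact ⟨l₁, h1, h2, h3, Or.inl h⟩
      · obtain ⟨l₁, h1, h2, h3⟩ := hnear (l - l₀) (by linarith)
        exact ⟨l, hup l₁ h1 l (by linarith) hl.2, h.le, by rw [abs_lt] at hll; linarith,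
          Or.inr rfl⟩
    obtain ⟨hl₁I, τ₁, h0, h1, hg⟩ := hl₁
    have hl₁0 : 0 < l₁ := hl₀pos.trans_le hge
    set τ := min τ₁ τ' with hτ
    have hτ0 : 0 < τ := lt_min h0 hτ'.1
    have hττ₁ : τ ≤ τ₁ := min_le_left _ _
    have hττ' : τ ≤ τ' := min_le_right _ _
    set c := min l₀ (δ / 2) with hc
    have hc0 : 0 < c := lt_min hl₀pos (by linarith)
    have hcl : c ≤ l₀ := min_le_left _ _
    have hcδ : c ≤ δ / 2 := min_le_right _ _
    set κ₂ := l * τ' / (l₁ * τ) with hκ₂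
    have hκ₂0 : 0 ≤ κ₂ := div_nonneg (mul_nonneg hl.1 hτ'.1.le) (by positivity)
    have hκ₂m : κ₂ * (l₁ * τ) = l * τ' := div_mul_cancel₀ _ (by positivity)
    set κ₁ := (κ₂ * (l₁ - l₀) - (l - l₀)) / c with hκ₁
    have hκ₁0 : 0 ≤ κ₁ := by
      refine div_nonneg ?_ hc0.le
      rcases hor with h | h
      · have := mul_nonneg hκ₂0 (sub_nonneg.2 hge)
        linarith
      · have hκ1 : 1 ≤ κ₂ := by
          rw [hκ₂, h, le_div_iff₀ (by rw [← h]; positivity), one_mul]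
          exact mul_le_mul_of_nonneg_left hττ' hl.1
        rw [h] at hge ⊢
        nlinarith
    have hcomb : κ₁ • -c • e + κ₂ • ((l₁ - l₀) • e + (l₁ * τ) • d) =
        (l - l₀) • e + (l * τ') • d := by
      have e1 : κ₁ * c = κ₂ * (l₁ - l₀) - (l - l₀) := div_mul_cancel₀ _ hc0.ne'
      rw [smul_add, smul_smul, smul_smul, smul_smul, hκ₂m, ← add_assoc, ← add_smul]
      congr 2
      linear_combination -e1
    have hτδ : τ ∈ Ioo (0 : ℝ) δ := ⟨hτ0, hττ'.trans_lt hτ'.2⟩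
    refine ⟨-c • e, (l₁ - l₀) • e + (l₁ * τ) • d, κ₁, κ₂, ?_, ?_, ?_, hκ₁0, hκ₂0, ?_, ?_, ?_,
      ⟨c, hc0, rfl⟩, ?_, (fun m : ℝ => x + m • (e + τ • d)) '' Icc l₁ 1, ?_, ?_, ?_, ?_, ?_⟩
    · have := hnorm (u := -c) (w := 0) (δ := δ) (by rw [abs_neg, abs_of_pos hc0]; linarith)
        (by simpa using hδ0) hδr
      simpa using this
    · refine hnorm (δ := δ) ?_ (hlτ hl₁I hτδ) hδr
      rw [abs_lt]; constructor <;> linarith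
    · rw [hcomb]
      exact hnorm hll (hlτ hl hτ') hδr
    · have := hxs (l₀ - c) ⟨by linarith, by linarith⟩
      rw [sub_smul] at this
      rw [hz, neg_smul, add_assoc, ← sub_eq_add_neg]
      exact this
    · rw [← hexp]
      exact hg l₁ ⟨le_rfl, hl₁I.2⟩ τ ⟨hτ0, hττ₁⟩
    · rw [hcomb, ← hexp]
      exact hnR
    · rw [cross2_add_right, cross2_smul_right, cross2_smul_right, cross2_self]
      have : 0 < (l₁ * τ) * (σ * cross2 e d) := by positivity
      linarith
    · exact isPreconnected_Icc.image _ (by fun_prop)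
    · rintro _ ⟨m, hm, rfl⟩
      exact hg m hm τ ⟨hτ0, hττ₁⟩
    · exact ⟨l₁, ⟨le_rfl, hl₁I.2⟩, hexp _ _⟩
    · exact ⟨τ, ⟨hτ0, hττ₁.trans h1⟩, 1, ⟨hl₁I.2, le_rfl⟩, by simp⟩
    · rintro _ ⟨m, hm, rfl⟩
      have hm0 : 0 < m := hl₁0.trans_le hm.1
      simp only
      rw [hexp, add_sub_cancel_left, cross2_add_right, cross2_smul_right, cross2_smul_right,
        cross2_self]
      have : 0 < (m * τ) * (σ * cross2 e d) := by positivity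
      linarith
  obtain ⟨i, j, j', r, hzi, hcor, g₁, g₂, κ₁, κ₂, n1, n2, n3, hκ₁, hκ₂, m1, m2, m3,
    ⟨c, hc, rfl⟩, heg, T, hT⟩ := exists_reflexCorner hσ hzb key
  rw [hzi] at m1 m2 m3 hT
  rw [hcor.mem_region_iff _ n1] at m1
  rw [hcor.mem_region_iff _ n2] at m2
  rw [hcor.mem_region_iff _ n3, not_not] at m3
  obtain ⟨k1, k2, k3⟩ := sector_crossing hσ hc hκ₁ hκ₂ hcor.cross_pos heg m1 m2 m3
  exact ⟨i, j, j', r, l₀, hcor, hl₀pos, hl₀1, hzi.symm, k1, k2, g₂, n2, k3, heg, T, hT⟩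

end SimplePolygon

theorem exists_nonneg_smul_of_mem_segment {z v q : E2} {t : ℝ} (ht : 0 ≤ t)
    (hq : q ∈ segment ℝ z (z + t • v)) : ∃ k : ℝ, 0 ≤ k ∧ k ≤ t ∧ q = z + k • v := by
  rw [mem_segment_add_iff] at hq
  obtain ⟨k, h0, h1, rfl⟩ := hq
  exact ⟨k * t, mul_nonneg h0 ht, mul_le_of_le_one_left ht h1, by rw [smul_smul]⟩

theorem smul_mem_segment {z v : E2} {k t : ℝ} (hk : 0 ≤ k) (hkt : k ≤ t) :
    z + k • v ∈ segment ℝ z (z + t • v) := by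
  rw [mem_segment_add_iff]
  rcases hk.eq_or_lt with rfl | hk0
  · exact ⟨0, le_rfl, zero_le_one, by simp⟩
  · have ht : 0 < t := hk0.trans_le hkt
    exact ⟨k / t, by positivity, (div_le_one ht).2 hkt,
      by rw [smul_smul, div_mul_cancel₀ _ ht.ne']⟩

namespace SimplePolygon

variable {P : SimplePolygon}

namespace ReflexCorner

variable {σ r : ℝ} {i j j' : ZMod P.n}

theorem isReflex (h : P.ReflexCorner σ i j j' r) : P.IsReflex i := by
  set a := P.vtx j - P.vtx i with ha
  set b := P.vtx j' - P.vtx i with hb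
  obtain ⟨η, hη, hsmall⟩ := exists_pos_smul_norm_lt ((2 : ℝ)⁻¹ • (a + b)) h.pos
  refine ⟨η, hη, fun ε hε hR => ?_⟩
  have hmid : midpoint ℝ (P.vtx i + ε • (P.vtx (i - 1) - P.vtx i))
      (P.vtx i + ε • (P.vtx (i + 1) - P.vtx i)) = P.vtx i + ε • (2 : ℝ)⁻¹ • (a + b) := by
    have hab : a + b = (P.vtx (i - 1) - P.vtx i) + (P.vtx (i + 1) - P.vtx i) := by
      rw [ha, hb]
      rcases h.adj with ⟨h1, h2⟩ | ⟨h1, h2⟩ <;> rw [h1, h2]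
      exact add_comm _ _
    rw [hab, midpoint_eq_smul_add, invOf_eq_inv]
    module
  rw [hmid, h.mem_region_iff _ (hsmall ε hε.1.le hε.2.le)] at hR
  apply hR
  have hp := h.cross_pos
  have hε0 : 0 < ε * 2⁻¹ := by have := hε.1; positivity
  rw [smul_smul]
  simp only [cross2_smul_right, cross2_smul_left, cross2_add_right, cross2_add_left, cross2_self,
    ← ha, ← hb, add_zero, zero_add]
  have := mul_pos hε0 hp
  constructor <;> linarith

theorem exists_chord (h : P.ReflexCorner σ i j j' r) {v : E2}
    (hv : σ * cross2 (P.vtx j' - P.vtx i) v < 0) :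
    ∃ t > 0, P.vtx i + t • v ∈ P.boundary ∧
      (∀ s ∈ Ioo (0 : ℝ) t, P.vtx i + s • v ∉ P.boundary) ∧
      segment ℝ (P.vtx i) (P.vtx i + t • v) ⊆ P.region ∧
      ∃ f : E2 → ℝ, ContinuousOn f (P.region \ segment ℝ (P.vtx i) (P.vtx i + t • v)) ∧
        (∀ q ∈ P.region \ segment ℝ (P.vtx i) (P.vtx i + t • v), (f q : Real.Angle) = 0) ∧
        ∀ q ∈ segment ℝ (P.vtx i) (P.vtx j), ∀ q' ∈ segment ℝ (P.vtx i) (P.vtx j'),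
          q ∉ segment ℝ (P.vtx i) (P.vtx i + t • v) →
          q' ∉ segment ℝ (P.vtx i) (P.vtx i + t • v) → f q ≠ f q' := by
  have hv0 : v ≠ 0 := by
    rintro rfl
    rw [cross2_zero_right, mul_zero] at hv
    exact lt_irrefl _ hv
  obtain ⟨η, hη, hsmall⟩ := exists_pos_smul_norm_lt v h.pos
  have hloc : ∀ t ∈ Ioo (0 : ℝ) η, P.vtx i + t • v ∈ P.region ∧ P.vtx i + t • v ∉ P.boundary := by
    intro t ht
    have hn := hsmall t ht.1.le ht.2.le
    have hneg : σ * cross2 (P.vtx j' - P.vtx i) (t • v) < 0 := by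
      rw [cross2_smul_right]
      have := mul_neg_of_pos_of_neg ht.1 hv
      linarith
    rw [h.mem_region_iff _ hn, h.mem_boundary_iff _ hn]
    refine ⟨fun h' => absurd h'.1 (not_lt.2 hneg.le), ?_⟩
    rintro (⟨k, hk, hk'⟩ | ⟨k, hk, hk'⟩)
    · rw [hk', cross2_smul_right] at hneg
      have := mul_nonneg hk h.cross_pos.le
      linarith
    · rw [hk', cross2_smul_right, cross2_self] at hneg
      simp at hneg
  obtain ⟨t, ht, hhit, hfirst, hseg⟩ :=
    P.exists_first_hit (P.boundary_subset_region (P.vtx_mem_boundary i)) hη hloc hv0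
  have hedge : ∀ k, P.vtx i ∈ P.edge k → P.vtx i + t • v ∉ P.edge k := by
    intro k hk hk'
    refine hfirst (t / 2) ⟨by linarith, by linarith⟩ (P.edge_subset_boundary k ?_)
    exact (convex_segment _ _).segment_subset hk hk' (smul_mem_segment (by linarith) (by linarith))
  have he1 : P.vtx i ∈ P.edge (i - 1) := by
    have := P.vtx_succ_mem_edge (i - 1)
    rwa [sub_add_cancel] at this
  obtain ⟨f, hf, hfa, hfne⟩ :=
    P.exists_separation hhit (hedge i (P.vtx_mem_edge i)) (hedge (i - 1) he1) hseg
  have e1 : segment ℝ (P.vtx i) (P.vtx (i + 1)) = P.edge i := rfl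
  have e2 : segment ℝ (P.vtx i) (P.vtx (i - 1)) = P.edge (i - 1) := by
    rw [edge, sub_add_cancel, segment_symm]
  refine ⟨t, ht, hhit, hfirst, hseg, f, hf, hfa, fun q hq q' hq' hqχ hq'χ => ?_⟩
  rcases h.adj with ⟨h1, h2⟩ | ⟨h1, h2⟩
  · rw [h1, e1] at hq
    rw [h2, e2] at hq'
    exact hfne q q' hq hq' hqχ hq'χ
  · rw [h1, e2] at hq
    rw [h2, e1] at hq'
    exact (hfne q' q hq' hq hq'χ hqχ).symm

/-- Short segments around the corner that avoid the exterior sector stay in the region. -/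
theorem segment_subset (h : P.ReflexCorner σ i j j' r) {u w v : E2} {t : ℝ} (ht : 0 ≤ t)
    (hu : ‖u‖ < r) (hw : ‖w‖ < r)
    (hE : ∀ α β : ℝ, 0 ≤ α → 0 ≤ β → α + β = 1 →
      (σ * cross2 (P.vtx j' - P.vtx i) (α • u + β • w) ≤ 0 ∨
        σ * cross2 (α • u + β • w) (P.vtx j - P.vtx i) ≤ 0) ∧
      ∀ k : ℝ, 0 ≤ k → α • u + β • w ≠ k • v) :
    segment ℝ (P.vtx i + u) (P.vtx i + w) ⊆
      P.region \ segment ℝ (P.vtx i) (P.vtx i + t • v) := by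
  rintro _ ⟨α, β, hα, hβ, hαβ, rfl⟩
  have heq : α • (P.vtx i + u) + β • (P.vtx i + w) = P.vtx i + (α • u + β • w) := by
    have : P.vtx i = (α + β) • P.vtx i := by rw [hαβ, one_smul]
    nth_rewrite 3 [this]
    module
  obtain ⟨h1, h2⟩ := hE α β hα hβ hαβ
  rw [heq]
  have hn : ‖α • u + β • w‖ < r := by
    have := (convex_ball (0 : E2) r) (by simpa using hu) (by simpa using hw) hα hβ hαβ
    simpa using this
  refine ⟨(h.mem_region_iff _ hn).2 fun h' => ?_, fun h' => ?_⟩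
  · rcases h1 with h1 | h1
    · exact absurd h'.1 (not_lt.2 h1)
    · exact absurd h'.2 (not_lt.2 h1)
  · obtain ⟨k, hk, -, hk'⟩ := exists_nonneg_smul_of_mem_segment ht h'
    exact h2 k hk (add_left_cancel hk')

end ReflexCorner

end SimplePolygon

/-! ### Pockets that miss an invisible component -/

theorem isPreconnected_smul_Ioc (z v : E2) (t : ℝ) :
    IsPreconnected ((fun k : ℝ => z + k • v) '' Ioc 0 t) :=
  isPreconnected_Ioc.image _ (by fun_prop)

namespace SimplePolygon

variable {P : SimplePolygon}

theorem mem_visSet_trans {x z q : E2} (hz : z ∈ segment ℝ x q) (h1 : segment ℝ x z ⊆ P.region)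
    (h2 : segment ℝ z q ⊆ P.region) : q ∈ P.visSet x := fun _ hp =>
  (mem_segment_or_mem_segment hz hp).elim (fun h => h1 h) fun h => h2 h

set_option maxHeartbeats 1000000 in
/-- An invisible connected set reached around a reflex corner misses the pocket of the cut
at that corner. -/
theorem ReflexCorner.exists_disjoint_pocket {σ r l : ℝ} {i j j' : ZMod P.n} {x e g : E2}
    {K T : Set E2} (h : P.ReflexCorner σ i j j' r) (hl : 0 < l) (hz : P.vtx i = x + l • e)
    (hxz : segment ℝ x (P.vtx i) ⊆ P.region)
    (hea : 0 ≤ σ * cross2 e (P.vtx j - P.vtx i)) (heb : 0 < σ * cross2 e (P.vtx j' - P.vtx i))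
    (hgr : ‖g‖ < r) (hbg : σ * cross2 (P.vtx j' - P.vtx i) g ≤ 0) (heg : 0 < σ * cross2 e g)
    (hT : IsPreconnected T) (hTR : T ⊆ P.region) (hgT : P.vtx i + g ∈ T)
    (hTe : ∀ q ∈ T, 0 < σ * cross2 e (q - P.vtx i)) (hK : IsPreconnected K)
    (hKR : K ⊆ P.region \ P.visSet x) (hKT : (K ∩ T).Nonempty) :
    ∃ C : P.Cut, Disjoint C.pocket K := by
  set a := P.vtx j - P.vtx i with ha
  set b := P.vtx j' - P.vtx i with hb
  have hva : P.vtx i - P.vtx j = -a := by rw [ha, neg_sub]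
  have hba : 0 < σ * cross2 b a := h.cross_pos
  have hbe : σ * cross2 b e < 0 := by rw [cross2_swap]; linarith
  -- the chord extending the line of sight
  obtain ⟨t, ht, hthit, htfirst, htR, f, hf, hfa, hfne⟩ := h.exists_chord hbe
  -- the chord extending the edge
  obtain ⟨t', ht', ht'hit, ht'first, ht'R, f', hf', hfa', hfne'⟩ :=
    h.exists_chord (v := P.vtx i - P.vtx j) (by
      rw [hva, cross2_neg_right, ← hb]; linarith)
  set χ := segment ℝ (P.vtx i) (P.vtx i + t • e) with hχ
  let C : P.Cut := ⟨i, j, h.adj.imp And.left And.left, h.isReflex, t', ht', ht'hit, ht'first,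
    ht'R⟩
  set s := segment ℝ (P.vtx i) (P.vtx i + t' • (P.vtx i - P.vtx j)) with hs
  have hpocket : C.pocket = closure (connectedComponentIn (P.region \ s) (P.vtx j)) ∪ s := rfl
  set W := connectedComponentIn (P.region \ s) (P.vtx j) with hW
  have hzray : ∀ k : ℝ, 0 ≤ k → P.vtx i ∈ segment ℝ x (P.vtx i + k • e) := by
    intro k hk
    rw [hz, add_assoc, ← add_smul]
    exact smul_mem_segment hl.le (by linarith)
  have hχS : χ ⊆ P.visSet x := by
    intro q hq
    obtain ⟨k, hk, hkt, rfl⟩ := exists_nonneg_smul_of_mem_segment ht.le hq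
    exact mem_visSet_trans (hzray k hk) hxz
      (((convex_segment _ _).segment_subset (left_mem_segment _ _ _) hq).trans htR)
  have hKχ : K ⊆ P.region \ χ := fun q hq => ⟨(hKR hq).1, fun h' => (hKR hq).2 (hχS h')⟩
  have hTχ : T ⊆ P.region \ χ := by
    refine fun q hq => ⟨hTR hq, fun h' => ?_⟩
    obtain ⟨k, hk, hkt, rfl⟩ := exists_nonneg_smul_of_mem_segment ht.le h'
    have := hTe _ hq
    rw [add_sub_cancel_left, cross2_smul_right, cross2_self] at this
    simp at this
  obtain ⟨κ, hκ, hκ1, hκt, hκt', hκa, hκb, hκe⟩ : ∃ κ : ℝ, 0 < κ ∧ κ ≤ 1 ∧ κ ≤ t ∧ κ ≤ t' ∧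
      ‖κ • a‖ < r ∧ ‖κ • b‖ < r ∧ ‖κ • e‖ < r := by
    obtain ⟨η₁, h1, H1⟩ := exists_pos_smul_norm_lt a h.pos
    obtain ⟨η₂, h2, H2⟩ := exists_pos_smul_norm_lt b h.pos
    obtain ⟨η₃, h3, H3⟩ := exists_pos_smul_norm_lt e h.pos
    have hpos : 0 < min 1 (min t (min t' (min η₁ (min η₂ η₃)))) := by positivity
    exact ⟨_, hpos, min_le_left _ _, by simp, by simp, H1 _ hpos.le (by simp), H2 _ hpos.le (by simp),
      H3 _ hpos.le (by simp)⟩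
  have hconst : ∀ {A : Set E2} {q q' : E2}, IsPreconnected A → A ⊆ P.region \ χ → q ∈ A →
      q' ∈ A → f q = f q' := fun hA hAs hq hq' =>
    eq_of_isPreconnected_of_coe_angle hA (hf.mono hAs) (fun q hq => hfa q (hAs hq)) hq hq'
  have hconst' : ∀ {A : Set E2} {q q' : E2}, IsPreconnected A → A ⊆ P.region \ s → q ∈ A →
      q' ∈ A → f' q = f' q' := fun hA hAs hq hq' =>
    eq_of_isPreconnected_of_coe_angle hA (hf'.mono hAs) (fun q hq => hfa' q (hAs hq)) hq hq'
  have hpre : ∀ u w : E2, IsPreconnected (segment ℝ u w) := fun u w =>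
    (convex_segment u w).isPreconnected
  -- the values of the two separating functions
  have hgb : segment ℝ (P.vtx i + g) (P.vtx i + κ • b) ⊆ P.region \ χ := by
    refine h.segment_subset ht.le hgr hκb fun α β hα hβ hαβ => ⟨Or.inl ?_, fun k hk hp => ?_⟩
    · rw [← hb]
      simp only [cross2_add_right, cross2_smul_right, cross2_self]
      nlinarith
    · have := congrArg (fun p => σ * cross2 e p) hp
      simp only [cross2_add_right, cross2_smul_right, cross2_self] at this
      have h1 := mul_nonneg hα heg.le
      have h2 := mul_nonneg (mul_nonneg hβ hκ.le) heb.le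
      rcases hα.eq_or_lt with rfl | hα
      · obtain rfl : β = 1 := by linarith
        nlinarith
      · nlinarith [mul_pos hα heg]
  have hbχ : P.vtx i + κ • b ∉ χ := (hgb (right_mem_segment _ _ _)).2
  have hκbmem : P.vtx i + κ • b ∈ segment ℝ (P.vtx i) (P.vtx j') := by
    have := smul_mem_segment (z := P.vtx i) (v := b) hκ.le hκ1
    rwa [one_smul, hb, add_sub_cancel] at this
  have hκamem : P.vtx i + κ • a ∈ segment ℝ (P.vtx i) (P.vtx j) := by
    have := smul_mem_segment (z := P.vtx i) (v := a) hκ.le hκ1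
    rwa [one_smul, ha, add_sub_cancel] at this
  have hjmem : P.vtx j ∈ segment ℝ (P.vtx i) (P.vtx j) := right_mem_segment _ _ _
  have hfK : ∀ q ∈ K, f q = f (P.vtx i + κ • b) := by
    intro q hq
    obtain ⟨q₀, hq₀K, hq₀T⟩ := hKT
    rw [hconst hK hKχ hq hq₀K, hconst hT hTχ hq₀T hgT,
      hconst (hpre _ _) hgb (left_mem_segment _ _ _) (right_mem_segment _ _ _)]
  have hjR : P.vtx j ∈ P.region := P.boundary_subset_region (P.vtx_mem_boundary j)
  have hjeq : P.vtx j = P.vtx i + a := by rw [ha, add_sub_cancel]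
  have hjχ : P.vtx j ∉ χ := by
    intro h'
    obtain ⟨k, hk, -, hk'⟩ := exists_nonneg_smul_of_mem_segment ht.le h'
    rw [hjeq] at hk'
    rw [add_left_cancel hk', cross2_smul_right] at hba
    nlinarith
  have hjs : P.vtx j ∉ s := by
    intro h'
    obtain ⟨k, hk, -, hk'⟩ := exists_nonneg_smul_of_mem_segment ht'.le h'
    rw [hva, hjeq] at hk'
    have := congrArg (fun p => σ * cross2 b p) (add_left_cancel hk')
    simp only [cross2_smul_right, cross2_neg_right] at this
    nlinarith [mul_nonneg hk hba.le]
  have hbs : P.vtx i + κ • b ∉ s := by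
    intro h'
    obtain ⟨k, hk, -, hk'⟩ := exists_nonneg_smul_of_mem_segment ht'.le h'
    rw [hva] at hk'
    have h1 := congrArg (fun p => σ * cross2 b p) (add_left_cancel hk')
    have h2 := congrArg (fun p => σ * cross2 p a) (add_left_cancel hk')
    simp only [cross2_smul_left, cross2_neg_left, cross2_self] at h2
    nlinarith [mul_pos hκ hba]
  have hfj : f (P.vtx j) ≠ f (P.vtx i + κ • b) := hfne _ hjmem _ hκbmem hjχ hbχ
  have hjW : P.vtx j ∈ W := mem_connectedComponentIn ⟨hjR, hjs⟩
  have hWs : W ⊆ P.region \ s := connectedComponentIn_subset _ _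
  have hWpre : IsPreconnected W := isPreconnected_connectedComponentIn
  have hzχ : P.vtx i ∈ χ := left_mem_segment _ _ _
  suffices hmain : Disjoint W χ ∧ ∀ q ∈ s, q ∈ K → f q ≠ f (P.vtx i + κ • b) by
    refine ⟨C, ?_⟩
    rw [hpocket, Set.disjoint_left]
    rintro q (hqW | hqs) hqK
    · have hWχ : W ⊆ P.region \ χ := fun q hq =>
        ⟨(hWs hq).1, Set.disjoint_left.1 hmain.1 hq⟩
      have hcl : f q ∈ closure (f '' W) :=
        ((hf q (hKχ hqK)).mono hWχ).mem_closure_image hqW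
      have hsub : f '' W ⊆ {f (P.vtx j)} := by
        rintro _ ⟨p, hp, rfl⟩
        exact hconst hWpre hWχ hp hjW
      have hqj : f q = f (P.vtx j) := by
        simpa using closure_mono hsub hcl
      exact hfj (hqj.symm.trans (hfK q hqK))
    · exact hmain.2 q hqs hqK (hfK q hqK)
  rcases hea.eq_or_lt with hea0 | hea0
  · -- the edge lies on the line of sight
    have hσ0 : σ ≠ 0 := by rcases h.sign with h' | h' <;> rw [h'] <;> norm_num
    have he0 : e ≠ 0 := by
      rintro rfl
      rw [cross2_zero_left, mul_zero] at heb
      exact lt_irrefl _ heb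
    obtain ⟨c, hc⟩ := exists_smul_of_cross2_eq_zero he0
      ((mul_eq_zero.1 hea0.symm).resolve_left hσ0)
    have hc0 : c < 0 := by
      rw [hc, cross2_smul_right] at hba
      by_contra hcn
      nlinarith
    have hvc : P.vtx i - P.vtx j = (-c) • e := by rw [hva, hc, neg_smul]
    have hle : t ≤ t' * -c := by
      by_contra hlt
      refine htfirst (t' * -c) ⟨by nlinarith, not_le.1 hlt⟩ ?_
      rw [mul_smul, ← hvc]
      exact ht'hit
    refine ⟨Set.disjoint_left.2 fun q hqW hqχ => (hWs hqW).2 ?_, fun q hqs hqK => ?_⟩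
    · obtain ⟨k, hk, hkt, rfl⟩ := exists_nonneg_smul_of_mem_segment ht.le hqχ
      rw [hs, hvc, smul_smul]
      exact smul_mem_segment hk (hkt.trans hle)
    · refine absurd ?_ (hKR hqK).2
      obtain ⟨k, hk, hkt, hqk⟩ := exists_nonneg_smul_of_mem_segment ht'.le hqs
      have hzq : P.vtx i ∈ segment ℝ x q := by
        rw [hqk, hvc, smul_smul]
        exact hzray _ (by nlinarith)
      exact mem_visSet_trans hzq hxz
        (((convex_segment _ _).segment_subset (left_mem_segment _ _ _) hqs).trans ht'R)
  · refine ⟨Set.disjoint_left.2 fun q hqW hqχ => ?_, fun q hqs hqK => ?_⟩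
    · have heb' : segment ℝ (P.vtx i + κ • e) (P.vtx i + κ • b) ⊆ P.region \ s := by
        refine h.segment_subset ht'.le hκe hκb fun α β hα hβ hαβ =>
          ⟨Or.inl ?_, fun k hk hp => ?_⟩
        · rw [← hb]
          simp only [cross2_add_right, cross2_smul_right, cross2_self]
          nlinarith [mul_nonneg hα hκ.le]
        · rw [hva] at hp
          have h1 := congrArg (fun p => σ * cross2 e p) hp
          have h2 := congrArg (fun p => σ * cross2 b p) hp
          simp only [cross2_add_right, cross2_smul_right, cross2_self, cross2_neg_right]
            at h1 h2
          have h3 := mul_nonneg (mul_nonneg hβ hκ.le) heb.le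
          have h4 := mul_nonneg hk hea0.le
          have hk0 : k = 0 := by
            have : k * (σ * cross2 e a) = 0 := by nlinarith
            exact (mul_eq_zero.1 this).resolve_right hea0.ne'
          subst hk0
          have hβ0 : β = 0 := by
            have : β * (κ * (σ * cross2 e b)) = 0 := by nlinarith
            exact (mul_eq_zero.1 this).resolve_right (mul_pos hκ heb).ne'
          subst hβ0
          obtain rfl : α = 1 := by linarith
          nlinarith
      have hray : (fun k : ℝ => P.vtx i + k • e) '' Ioc 0 t ⊆ P.region \ s := by
        rintro _ ⟨k, hk, rfl⟩
        refine ⟨htR (smul_mem_segment hk.1.le hk.2), fun h' => ?_⟩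
        obtain ⟨k', hk0, -, hk'⟩ := exists_nonneg_smul_of_mem_segment ht'.le h'
        rw [hva] at hk'
        have h1 := congrArg (fun p => σ * cross2 b p) (add_left_cancel hk')
        have h2 := congrArg (fun p => σ * cross2 e p) (add_left_cancel hk')
        simp only [cross2_smul_right, cross2_self, cross2_neg_right] at h1 h2
        have hk0 : k' = 0 := by
          have : k' * (σ * cross2 e a) = 0 := by nlinarith
          exact (mul_eq_zero.1 this).resolve_right hea0.ne'
        subst hk0
        nlinarith [mul_neg_of_pos_of_neg hk.1 hbe]
      obtain ⟨k, hk, hkt, rfl⟩ := exists_nonneg_smul_of_mem_segment ht.le hqχ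
      have hk0 : 0 < k := by
        refine lt_of_le_of_ne hk ?_
        rintro rfl
        refine (hWs hqW).2 ?_
        rw [zero_smul, add_zero]
        exact left_mem_segment _ _ _
      refine hfne' _ hjmem _ hκbmem hjs hbs ?_
      rw [hconst' hWpre hWs hjW hqW,
        hconst' (isPreconnected_smul_Ioc _ _ _) hray ⟨k, ⟨hk0, hkt⟩, rfl⟩
          ⟨κ, ⟨hκ, hκt⟩, rfl⟩,
        hconst' (hpre _ _) heb' (left_mem_segment _ _ _) (right_mem_segment _ _ _)]
    · obtain ⟨k, hk, hkt, rfl⟩ := exists_nonneg_smul_of_mem_segment ht'.le hqs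
      have hk0 : 0 < k := by
        refine lt_of_le_of_ne hk ?_
        rintro rfl
        refine (hKχ hqK).2 ?_
        rw [zero_smul, add_zero]
        exact hzχ
      have hray : (fun k : ℝ => P.vtx i + k • (P.vtx i - P.vtx j)) '' Ioc 0 t' ⊆
          P.region \ χ := by
        rintro _ ⟨k, hk, rfl⟩
        refine ⟨ht'R (smul_mem_segment hk.1.le hk.2), fun h' => ?_⟩
        obtain ⟨k', -, -, hk'⟩ := exists_nonneg_smul_of_mem_segment ht.le h'
        have h2 := congrArg (fun p => σ * cross2 e p) (add_left_cancel hk')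
        simp only [hva, cross2_smul_right, cross2_self, cross2_neg_right] at h2
        nlinarith [mul_pos hk.1 hea0]
      have key : ∀ k : ℝ, 0 ≤ k → -(κ • e) ≠ k • e := by
        intro k hk hp
        have := congrArg (fun p => σ * cross2 b p) hp
        simp only [cross2_smul_right, cross2_neg_right] at this
        nlinarith [mul_nonneg hk (neg_nonneg.2 hbe.le), mul_pos hκ (neg_pos.2 hbe)]
      have hseg₁ : segment ℝ (P.vtx i + -(κ • a)) (P.vtx i + -(κ • e)) ⊆ P.region \ χ := by
        refine h.segment_subset ht.le (by rwa [norm_neg]) (by rwa [norm_neg])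
          fun α β hα hβ hαβ => ⟨Or.inr ?_, fun k hk hp => ?_⟩
        · rw [← ha]
          simp only [cross2_add_left, cross2_smul_left, cross2_self, cross2_neg_left]
          nlinarith [mul_nonneg (mul_nonneg hβ hκ.le) hea0.le]
        · have h1 := congrArg (fun p => σ * cross2 e p) hp
          simp only [cross2_add_right, cross2_smul_right, cross2_self, cross2_neg_right] at h1
          have hα0 : α = 0 := by
            have : α * (κ * (σ * cross2 e a)) = 0 := by linarith
            exact (mul_eq_zero.1 this).resolve_right (mul_pos hκ hea0).ne'
          subst hα0
          obtain rfl : β = 1 := by linarith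
          exact key k hk (by simpa using hp)
      have hseg₂ : segment ℝ (P.vtx i + -(κ • e)) (P.vtx i + κ • a) ⊆ P.region \ χ := by
        refine h.segment_subset ht.le (by rwa [norm_neg]) hκa
          fun α β hα hβ hαβ => ⟨Or.inr ?_, fun k hk hp => ?_⟩
        · rw [← ha]
          simp only [cross2_add_left, cross2_smul_left, cross2_self, cross2_neg_left]
          nlinarith [mul_nonneg (mul_nonneg hα hκ.le) hea0.le]
        · have h1 := congrArg (fun p => σ * cross2 e p) hp
          simp only [cross2_add_right, cross2_smul_right, cross2_self, cross2_neg_right] at h1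
          have hβ0 : β = 0 := by
            have : β * (κ * (σ * cross2 e a)) = 0 := by linarith
            exact (mul_eq_zero.1 this).resolve_right (mul_pos hκ hea0).ne'
          subst hβ0
          obtain rfl : α = 1 := by linarith
          exact key k hk (by simpa using hp)
      have hκv : P.vtx i + κ • (P.vtx i - P.vtx j) = P.vtx i + -(κ • a) := by
        rw [hva, smul_neg]
      rw [hconst (isPreconnected_smul_Ioc _ _ _) hray ⟨k, ⟨hk0, hkt⟩, rfl⟩
          ⟨κ, ⟨hκ, hκt'⟩, hκv⟩,
        hconst (hpre _ _) hseg₁ (left_mem_segment _ _ _) (right_mem_segment _ _ _),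
        hconst (hpre _ _) hseg₂ (left_mem_segment _ _ _) (right_mem_segment _ _ _)]
      exact hfne _ hκamem _ hκbmem (hseg₂ (right_mem_segment _ _ _)).2 hbχ

end SimplePolygon

namespace SimplePolygon

variable {P : SimplePolygon}

/-! ### Nonredundant cuts -/

theorem Cut.eq_of_generator_eq {C C' : P.Cut} (hi : C.i = C'.i) (hj : C.j = C'.j) : C = C' := by
  obtain ⟨i, j, adj, reflex, t, t_pos, hits, first_hit, inside⟩ := C
  obtain ⟨i', j', adj', reflex', t', t_pos', hits', first_hit', inside'⟩ := C'
  dsimp only at hi hj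
  subst hi hj
  obtain rfl : t = t' := by
    rcases lt_trichotomy t t' with h | h | h
    · exact absurd hits (first_hit' t ⟨t_pos, h⟩)
    · exact h
    · exact absurd hits' (first_hit t' ⟨t_pos', h⟩)
  rfl

instance : Finite P.Cut :=
  Finite.of_injective (fun C : P.Cut => (C.i, C.j)) fun _ _ h =>
    Cut.eq_of_generator_eq (congrArg Prod.fst h) (congrArg Prod.snd h)

theorem Cut.exists_nonredundant_pocket_subset (C : P.Cut) :
    ∃ C' : P.Cut, C'.Nonredundant ∧ C'.pocket ⊆ C.pocket := by
  obtain ⟨_, hle, ⟨C', rfl⟩, hmin⟩ :=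
    (Set.finite_range (Cut.pocket (P := P))).exists_le_minimal ⟨C, rfl⟩
  refine ⟨C', ?_, hle⟩
  rintro ⟨D, hD⟩
  exact hD.2 (hmin ⟨D, rfl⟩ hD.1)

theorem Cut.pocketVertex_mem_region {C : P.Cut} {x : E2} (hx : C.PocketVertex x) :
    x ∈ P.region := by
  rcases hx with rfl | ⟨k, rfl, -⟩
  · exact C.inside (right_mem_segment _ _ _)
  · exact P.boundary_subset_region (P.vtx_mem_boundary k)

/-- A component of the invisible part of the region is left transversally to the line of
sight. -/
theorem cross2_ne_zero_of_escape {x e d : E2} (hxs : ∀ l ∈ Icc (0 : ℝ) 1, x + l • e ∈ P.region)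
    (hd : ∀ t ∈ Ioc (0 : ℝ) 1, x + (e + t • d) ∈ P.region \ P.visSet x) : cross2 e d ≠ 0 := by
  intro h0
  have hray : ∀ q, x + e ∈ segment ℝ x q → q = x + (e + (1 : ℝ) • d) → False := by
    intro q hq hq'
    refine (hd 1 (by simp)).2 (hq' ▸ mem_visSet_trans hq ?_ ?_)
    · intro p hp
      obtain ⟨k, h0, h1, rfl⟩ := mem_segment_add_iff.1 hp
      exact hxs k ⟨h0, h1⟩
    · intro p hp
      rw [hq', one_smul, ← add_assoc] at hp
      obtain ⟨k, h0, h1, rfl⟩ := mem_segment_add_iff.1 hp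
      rcases h0.eq_or_lt with rfl | h0
      · simpa using hxs 1 (by simp)
      · rw [add_assoc]
        exact (hd k ⟨h0, h1⟩).1
  by_cases he : e = 0
  · refine hray _ ?_ rfl
    rw [he, add_zero]
    exact left_mem_segment _ _ _
  obtain ⟨k, rfl⟩ := exists_smul_of_cross2_eq_zero he h0
  rcases le_or_gt 0 k with hk | hk
  · refine hray (x + (1 + k) • e) ?_ (by module)
    simpa using smul_mem_segment (z := x) (v := e) zero_le_one (show (1 : ℝ) ≤ 1 + k by linarith)
  · have hpos : 0 < 1 - k := by linarith
    have ht : (1 - k)⁻¹ ∈ Ioc (0 : ℝ) 1 := ⟨by positivity, inv_le_one_of_one_le₀ (by linarith)⟩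
    have hle : 0 ≤ 1 + (1 - k)⁻¹ * k := by
      field_simp
      norm_num
    have hle₁ : 1 + (1 - k)⁻¹ * k ≤ 1 := by nlinarith [ht.1]
    refine (hd _ ht).2 (P.mem_visSet_iff.2 fun t' ht' => ?_)
    have : x + t' • (x + (e + (1 - k)⁻¹ • k • e) - x) = x + (t' * (1 + (1 - k)⁻¹ * k)) • e := by
      module
    rw [this]
    exact hxs _ ⟨mul_nonneg ht'.1 hle, mul_le_one₀ ht'.2 hle hle₁⟩

/-- A connected component of the invisible part of the region misses the pocket of some cut. -/
theorem exists_disjoint_pocket_of_not_visible {x p : E2} (hx : x ∈ P.region) (hp : p ∈ P.region)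
    (hpx : p ∉ P.visSet x) : ∃ C : P.Cut,
      Disjoint C.pocket (connectedComponentIn (P.region \ P.visSet x) p) := by
  obtain ⟨s, d, hs, hd⟩ := P.exists_escape hx hp hpx
  have hKs := connectedComponentIn_subset (P.region \ P.visSet x) p
  obtain ⟨e, rfl⟩ : ∃ e, s = x + e := ⟨s - x, by rw [add_sub_cancel]⟩
  simp only [add_assoc] at hd
  have hxs : ∀ l ∈ Icc (0 : ℝ) 1, x + l • e ∈ P.region := by
    simpa only [add_sub_cancel_left] using P.mem_visSet_iff.1 hs
  have hne := cross2_ne_zero_of_escape hxs fun t ht => hKs (hd t ht)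
  obtain ⟨σ, hσ, hpos⟩ : ∃ σ : ℝ, (σ = 1 ∨ σ = -1) ∧ 0 < σ * cross2 e d := by
    rcases hne.lt_or_gt with h | h
    · exact ⟨-1, Or.inr rfl, by linarith⟩
    · exact ⟨1, Or.inl rfl, by linarith⟩
  obtain ⟨i, j, j', r, l, hc, hl, hl1, hz, hea, heb, g, hg, hbg, heg, T, hT, hTR, hgT,
    ⟨t, ht, htT⟩, hTe⟩ := exists_reflex_view hσ hxs (fun t ht => (hKs (hd t ht)).1)
      (fun t ht => (hKs (hd t ht)).2) hpos
  refine hc.exists_disjoint_pocket hl hz ?_ hea heb hg hbg heg hT hTR hgT hTe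
    isPreconnected_connectedComponentIn hKs ⟨_, hd t ht, htT⟩
  intro q hq
  rw [hz] at hq
  obtain ⟨k, hk, hkl, rfl⟩ := exists_nonneg_smul_of_mem_segment hl.le hq
  exact hxs k ⟨hk, hkl.trans hl1⟩

end SimplePolygon

/-- If a connected curve inside `P` intersects every nonredundant cut
of `P`, then for every nonredundant cut `C`, every vertex of `Pocket(C)` is visible
from some point of the curve. -/
theorem pocket_vertices_visible_from_path
    (P : SimplePolygon) (Pth : Set E2) (hsub : Pth ⊆ P.region) (hconn : IsConnected Pth)
    (hcuts : ∀ C : P.Cut, C.Nonredundant → (Pth ∩ C.seg).Nonempty) :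
    ∀ C : P.Cut, C.Nonredundant → ∀ x : E2, C.PocketVertex x →
      ∃ p ∈ Pth, P.Visible x p := by
  intro C _ x hx
  by_contra! hinv
  obtain ⟨p, hp⟩ := hconn.nonempty
  obtain ⟨D, hD⟩ := SimplePolygon.exists_disjoint_pocket_of_not_visible
    (SimplePolygon.Cut.pocketVertex_mem_region hx) (hsub hp) (hinv p hp)
  obtain ⟨D', hD', hsubset⟩ := D.exists_nonredundant_pocket_subset
  obtain ⟨q, hqP, hqs⟩ := hcuts D' hD'
  have hPth : Pth ⊆ P.region \ P.visSet x := fun y hy => ⟨hsub hy, hinv y hy⟩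
  exact Set.disjoint_left.1 hD (hsubset (Or.inr hqs))
    (hconn.isPreconnected.subset_connectedComponentIn hp hPth hqP)
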